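/- Every graph G that is an induced subgraph of an icosahedral thickening satisfies χ(G) ≤ γ_ℓ(G). -/

import Mathlib

open SimpleGraph

namespace Paper

variable {V : Type*} {W : Type*}

/-- A graph is claw-free if no vertex has three pairwise nonadjacent neighbours. -/
def ClawFree (G : SimpleGraph V) : Prop :=
  ¬ ∃ (v a b c : V), G.Adj v a ∧ G.Adj v b ∧ G.Adj v c ∧
      ¬G.Adj a b ∧ ¬G.Adj a c ∧ ¬G.Adj b c ∧ a ≠ b ∧ a ≠ c ∧ b ≠ c

/-- A graph is quasi-line if every neighbourhood is covered by two cliques. -/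
def QuasiLine (G : SimpleGraph V) : Prop :=
  ∀ v : V, ∃ S T : Set V, G.IsClique S ∧ G.IsClique T ∧ G.neighborSet v ⊆ S ∪ T

/-- The clique number ω(G). -/
noncomputable def cliqueNum (G : SimpleGraph V) : ℕ :=
  sSup {n | ∃ s : Finset V, G.IsNClique n s}

/-- The clique number of the subgraph induced on a vertex set `S`. -/
noncomputable def cliqueNumOn (G : SimpleGraph V) (S : Set V) : ℕ :=
  sSup {n | ∃ s : Finset V, ↑s ⊆ S ∧ G.IsNClique n s}

/-- ω(v): the maximum size of a clique containing `v`. -/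
noncomputable def omegaAt (G : SimpleGraph V) (v : V) : ℕ :=
  sSup {n | ∃ s : Finset V, G.IsNClique n s ∧ v ∈ s}

/-- The degree of a vertex (as the cardinality of its neighbourhood). -/
noncomputable def degree' (G : SimpleGraph V) (v : V) : ℕ := (G.neighborSet v).ncard

/-- The maximum degree Δ(G). -/
noncomputable def maxDeg (G : SimpleGraph V) : ℕ := sSup {n | ∃ v : V, n = degree' G v}

/-- γ_ℓ(v) = ⌈(d(v)+1+ω(v))/2⌉. -/
noncomputable def gammaLocalAt (G : SimpleGraph V) (v : V) : ℕ :=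
  (degree' G v + 1 + omegaAt G v + 1) / 2

/-- γ_ℓ(G) = max over vertices of γ_ℓ(v). -/
noncomputable def gammaLocal (G : SimpleGraph V) : ℕ :=
  sSup {n | ∃ v : V, n = gammaLocalAt G v}

/-- The closed neighbourhood of a vertex. -/
def closedNbhd (G : SimpleGraph V) (v : V) : Set V := insert v (G.neighborSet v)

/-- The closed neighbourhood within an induced subgraph on `S`. -/
def closedNbhdOn (G : SimpleGraph V) (S : Set V) (v : V) : Set V := S ∩ closedNbhd G v

/-- A triad: three pairwise nonadjacent vertices. -/
def IsTriad (G : SimpleGraph V) (T : Finset V) : Prop :=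
  T.card = 3 ∧ ∀ u ∈ T, ∀ w ∈ T, u ≠ w → ¬G.Adj u w

/-- A good triad within the induced subgraph on `S`: every vertex of the induced subgraph
outside `T` has two neighbours in `T`, or a twin in `T`, or is trumped by a vertex of `T`. -/
def GoodTriadOn (G : SimpleGraph V) (S : Set V) (T : Finset V) : Prop :=
  ↑T ⊆ S ∧ IsTriad G T ∧
    ∀ v ∈ S, v ∉ T →
      (∃ t1 ∈ T, ∃ t2 ∈ T, t1 ≠ t2 ∧ G.Adj v t1 ∧ G.Adj v t2) ∨
      (∃ t ∈ T, closedNbhdOn G S v = closedNbhdOn G S t) ∨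
      (∃ t ∈ T, closedNbhdOn G S v ⊂ closedNbhdOn G S t)

/-- A good triad in `G`. -/
def GoodTriad (G : SimpleGraph V) (T : Finset V) : Prop := GoodTriadOn G Set.univ T

/-- A homogeneous pair of cliques within the induced subgraph on `S`. -/
def IsHomPairOn (G : SimpleGraph V) (S : Set V) (A B : Finset V) : Prop :=
  ↑A ⊆ S ∧ ↑B ⊆ S ∧ G.IsClique (↑A : Set V) ∧ G.IsClique (↑B : Set V) ∧
    A.Nonempty ∧ B.Nonempty ∧ Disjoint A B ∧ 3 ≤ A.card + B.card ∧
    ∀ v ∈ S, v ∉ A → v ∉ B →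
      ((∀ a ∈ A, G.Adj v a) ∨ (∀ a ∈ A, ¬G.Adj v a)) ∧
      ((∀ b ∈ B, G.Adj v b) ∨ (∀ b ∈ B, ¬G.Adj v b))

/-- A homogeneous pair of cliques in `G`. -/
def IsHomPair (G : SimpleGraph V) (A B : Finset V) : Prop := IsHomPairOn G Set.univ A B

/-- A homogeneous pair of cliques `(A,B)` is skeletal if deleting any single edge
between `A` and `B` strictly decreases the clique number of `G[A ∪ B]`. -/
def IsSkeletalPair (G : SimpleGraph V) (A B : Finset V) : Prop :=
  ∀ a ∈ A, ∀ b ∈ B, G.Adj a b →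
    cliqueNumOn (G.deleteEdges {s(a, b)}) (↑A ∪ ↑B) < cliqueNumOn G (↑A ∪ ↑B)

/-- A graph is skeletal if every homogeneous pair of cliques in it is skeletal. -/
def Skeletal (G : SimpleGraph V) : Prop :=
  ∀ A B : Finset V, IsHomPair G A B → IsSkeletalPair G A B

/-- A linear pair: no induced C₄ between `A` and `B`. -/
def IsLinearPair (G : SimpleGraph V) (A B : Finset V) : Prop :=
  ¬ ∃ a1 ∈ A, ∃ a2 ∈ A, ∃ b1 ∈ B, ∃ b2 ∈ B,
      G.Adj a1 b1 ∧ G.Adj a2 b2 ∧ ¬G.Adj a1 b2 ∧ ¬G.Adj a2 b1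

/-- A homogeneous clique. -/
def IsHomogeneousClique [Fintype V] (G : SimpleGraph V) (C : Finset V) : Prop :=
  G.IsClique (↑C : Set V) ∧ 2 ≤ C.card ∧ C.card ≤ Fintype.card V - 1 ∧
    ∀ v ∉ C, (∀ c ∈ C, G.Adj v c) ∨ (∀ c ∈ C, ¬G.Adj v c)

/-- `X` straddles the three-cliquing `(A,B,C)` if it meets more than one of `A`, `B`, `C`. -/
def Straddles (A B C : Set V) (X : Finset V) : Prop :=
  ((↑X ∩ A).Nonempty ∧ (↑X ∩ B).Nonempty) ∨
  ((↑X ∩ A).Nonempty ∧ (↑X ∩ C).Nonempty) ∨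
  ((↑X ∩ B).Nonempty ∧ (↑X ∩ C).Nonempty)

/-- A three-cliqued graph is weakly skeletal if every nonskeletal homogeneous pair
of cliques is straddling. -/
def WeaklySkeletal (G : SimpleGraph V) (A B C : Set V) : Prop :=
  ∀ X Y : Finset V, IsHomPair G X Y → ¬IsSkeletalPair G X Y →
    Straddles A B C X ∨ Straddles A B C Y

/-- A set of unordered pairs forming a matching (pairwise disjoint non-loop pairs). -/
def IsMatchingSet (M : Set (Sym2 W)) : Prop :=
  (∀ e ∈ M, ¬e.IsDiag) ∧ ∀ e ∈ M, ∀ e' ∈ M, e ≠ e' → ∀ w : W, w ∈ e → w ∉ e'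

/-- `G[D]` is a thickening of `H[R]` under the matching `M`, via the fiber map `f`. -/
structure IsThickeningBetween (H : SimpleGraph W) (M : Set (Sym2 W)) (R : Set W)
    (G : SimpleGraph V) (D : Set V) (f : V → W) : Prop where
  maps_into : ∀ v ∈ D, f v ∈ R
  fibers_nonempty : ∀ w ∈ R, ∃ v ∈ D, f v = w
  fibers_clique : ∀ w : W, G.IsClique {v | v ∈ D ∧ f v = w}
  adj_of_adj : ∀ u ∈ D, ∀ v ∈ D, f u ≠ f v → H.Adj (f u) (f v) → s(f u, f v) ∉ M → G.Adj u v
  nonadj_of_nonadj : ∀ u ∈ D, ∀ v ∈ D, f u ≠ f v → ¬H.Adj (f u) (f v) → ¬G.Adj u v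
  semi_adj : ∀ x ∈ R, ∀ y ∈ R, s(x, y) ∈ M →
    ∃ u ∈ D, ∃ v ∈ D, f u = x ∧ f v = y ∧ G.Adj u v
  semi_nonadj : ∀ x ∈ R, ∀ y ∈ R, s(x, y) ∈ M →
    ∃ u ∈ D, ∃ v ∈ D, f u = x ∧ f v = y ∧ ¬G.Adj u v

/-- `G` is a thickening of `H[R]` under `M`. -/
def IsThickeningOn (H : SimpleGraph W) (M : Set (Sym2 W)) (R : Set W)
    (G : SimpleGraph V) (f : V → W) : Prop :=
  IsThickeningBetween H M R G Set.univ f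

/-- `G` is a thickening of `H` under `M`. -/
def IsThickening (H : SimpleGraph W) (M : Set (Sym2 W)) (G : SimpleGraph V) (f : V → W) : Prop :=
  IsThickeningBetween H M Set.univ G Set.univ f

/-- A graph is antiprismatic if every vertex outside a triad has exactly two
neighbours in it. -/
def Antiprismatic (H : SimpleGraph W) : Prop :=
  ∀ T : Finset W, IsTriad H T → ∀ v ∉ T,
    ∃ t ∈ T, ¬H.Adj v t ∧ ∀ t' ∈ T, t' ≠ t → H.Adj v t'

/-- A changeable matching in an antiprismatic graph. -/
def ChangeableMatching (H : SimpleGraph W) (M : Set (Sym2 W)) : Prop :=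
  M ⊆ H.edgeSet ∧ IsMatchingSet M ∧ ∀ M' ⊆ M, Antiprismatic (H.deleteEdges M')



/-- The icosahedron `G0` on vertices `v0, …, v11`. -/
def icoG0 : SimpleGraph (Fin 12) :=
  SimpleGraph.fromRel (fun i j =>
    (1 ≤ i.val ∧ i.val ≤ 10 ∧ (j.val = i.val % 10 + 1 ∨ j.val = (i.val + 1) % 10 + 1)) ∨
    (i.val = 0 ∧ j.val % 2 = 1 ∧ 1 ≤ j.val ∧ j.val ≤ 10) ∨
    (i.val = 11 ∧ j.val % 2 = 0 ∧ 1 ≤ j.val ∧ j.val ≤ 10))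

/-- `G1 = G0 − v11`. -/
def icoG1 : SimpleGraph (Fin 11) :=
  SimpleGraph.fromRel (fun i j =>
    (1 ≤ i.val ∧ (j.val = i.val % 10 + 1 ∨ j.val = (i.val + 1) % 10 + 1)) ∨
    (i.val = 0 ∧ j.val % 2 = 1))

/-- `G2 = G1 − v10`. -/
def icoG2 : SimpleGraph (Fin 10) :=
  SimpleGraph.fromRel (fun i j =>
    (1 ≤ i.val ∧ (j.val = i.val % 10 + 1 ∨ j.val = (i.val + 1) % 10 + 1)) ∨
    (i.val = 0 ∧ j.val % 2 = 1))

/-- An icosahedral thickening: a proper thickening of `G0` or `G1`, or a thickening of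
`G2 ∪ M` under a matching `M ⊆ {v1v4, v6v9}`. -/
def IsIcosahedralThickening (G : SimpleGraph V) : Prop :=
  (∃ f : V → Fin 12, IsThickening icoG0 ∅ G f) ∨
  (∃ f : V → Fin 11, IsThickening icoG1 ∅ G f) ∨
  (∃ (M : Set (Sym2 (Fin 10))) (f : V → Fin 10),
      M ⊆ {s((1 : Fin 10), 4), s(6, 9)} ∧
      IsThickening (icoG2 ⊔ SimpleGraph.fromEdgeSet M) M G f)

/-! ### Antihat graphs -/

/-- The vertex type of the antihat base graph: `A = {a0,…,ak}`, `B = {b0,…,bk}`,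
`C = {c1,…,ck}` (the third component `i` encodes `c_{i+1}`). -/
abbrev AHV (k : ℕ) : Type := Fin (k + 1) ⊕ Fin (k + 1) ⊕ Fin k

def ahA {k : ℕ} (i : Fin (k + 1)) : AHV k := Sum.inl i
def ahB {k : ℕ} (i : Fin (k + 1)) : AHV k := Sum.inr (Sum.inl i)
def ahC {k : ℕ} (i : Fin k) : AHV k := Sum.inr (Sum.inr i)

/-- The antihat base graph `H`, where `e00` records whether `a0` and `b0` are adjacent. -/
def antihatH (k : ℕ) (e00 : Bool) : SimpleGraph (AHV k) :=
  SimpleGraph.fromRel (fun x y =>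
    match x, y with
    | Sum.inl _, Sum.inl _ => True
    | Sum.inr (Sum.inl _), Sum.inr (Sum.inl _) => True
    | Sum.inr (Sum.inr _), Sum.inr (Sum.inr _) => True
    | Sum.inl i, Sum.inr (Sum.inl j) =>
        (i = j ∧ 1 ≤ i.val) ∨ (i.val = 0 ∧ j.val = 0 ∧ e00 = true)
    | Sum.inl i, Sum.inr (Sum.inr j) => 1 ≤ i.val ∧ i.val ≠ j.val + 1
    | Sum.inr (Sum.inl i), Sum.inr (Sum.inr j) => 1 ≤ i.val ∧ i.val ≠ j.val + 1
    | _, _ => False)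

/-- The conditions on the matching `M` of an antihat thickening with deleted set `Xd`. -/
def AntihatM (k : ℕ) (e00 : Bool) (Xd : Finset (AHV k)) (M : Set (Sym2 (AHV k))) : Prop :=
  IsMatchingSet M ∧
  (∀ e ∈ M, ∀ w : AHV k, w ∈ e → w ∉ Xd) ∧
  (∀ i j : Fin (k + 1), s(ahA i, ahA j) ∉ M) ∧
  (∀ i j : Fin (k + 1), s(ahB i, ahB j) ∉ M) ∧
  (∀ i j : Fin k, s(ahC i, ahC j) ∉ M) ∧
  (e00 = true → s(ahA (0 : Fin (k + 1)), ahB (0 : Fin (k + 1))) ∈ M) ∧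
  (∀ i j : Fin (k + 1), 1 ≤ i.val → 1 ≤ j.val → s(ahA i, ahB j) ∈ M →
      i = j ∧ ∃ c : Fin k, c.val + 1 = i.val ∧ ahC c ∈ Xd) ∧
  (∀ i : Fin (k + 1), ∀ j : Fin k, 1 ≤ i.val → s(ahB i, ahC j) ∈ M →
      i.val = j.val + 1 ∧ ahA i ∈ Xd) ∧
  (∀ i : Fin (k + 1), ∀ j : Fin k, 1 ≤ i.val → s(ahA i, ahC j) ∈ M →
      i.val = j.val + 1 ∧ ahB i ∈ Xd)

/-! ### Strips and generalized 2-joins -/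

/-- The induced subgraph on `S` contains an induced `W5` (a 5-wheel). -/
def HasInducedW5On (G : SimpleGraph V) (S : Set V) : Prop :=
  ∃ w c0 c1 c2 c3 c4 : V,
    w ∈ S ∧ c0 ∈ S ∧ c1 ∈ S ∧ c2 ∈ S ∧ c3 ∈ S ∧ c4 ∈ S ∧
    G.Adj w c0 ∧ G.Adj w c1 ∧ G.Adj w c2 ∧ G.Adj w c3 ∧ G.Adj w c4 ∧
    G.Adj c0 c1 ∧ G.Adj c1 c2 ∧ G.Adj c2 c3 ∧ G.Adj c3 c4 ∧ G.Adj c4 c0 ∧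
    c0 ≠ c2 ∧ c0 ≠ c3 ∧ c1 ≠ c3 ∧ c1 ≠ c4 ∧ c2 ≠ c4 ∧
    ¬G.Adj c0 c2 ∧ ¬G.Adj c0 c3 ∧ ¬G.Adj c1 c3 ∧ ¬G.Adj c1 c4 ∧ ¬G.Adj c2 c4

/-- A generalized 2-join `((X1,Y1),(X2,Y2))` of `G` separating `V1` from `V2`,
with `X1, X2, Y1, Y2` pairwise disjoint except possibly `X1` and `Y1`. -/
structure IsGen2Join [Fintype V] [DecidableEq V] (G : SimpleGraph V)
    (V1 V2 X1 Y1 X2 Y2 : Finset V) : Prop where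
  disjV : Disjoint V1 V2
  unionV : V1 ∪ V2 = Finset.univ
  subX1 : X1 ⊆ V1
  subY1 : Y1 ⊆ V1
  subX2 : X2 ⊆ V2
  subY2 : Y2 ⊆ V2
  cliqueX : G.IsClique (↑X1 ∪ ↑X2 : Set V)
  cliqueY : G.IsClique (↑Y1 ∪ ↑Y2 : Set V)
  cross : ∀ u ∈ V1, ∀ v ∈ V2, G.Adj u v → (u ∈ X1 ∧ v ∈ X2) ∨ (u ∈ Y1 ∧ v ∈ Y2)
  disjX2Y2 : Disjoint X2 Y2

/-- ω'(v): the maximum size of a clique of `H2 = G[V2 ∪ X1 ∪ Y1]` containing `v`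
and not intersecting both `X1 ∖ Y1` and `Y1 ∖ X1`. -/
noncomputable def omegaJ [DecidableEq V] (G : SimpleGraph V) (V2 X1 Y1 : Finset V) (v : V) : ℕ :=
  sSup {n | ∃ s : Finset V, G.IsNClique n s ∧ v ∈ s ∧ s ⊆ V2 ∪ X1 ∪ Y1 ∧
      ¬((∃ x ∈ s, x ∈ X1 ∧ x ∉ Y1) ∧ ∃ y ∈ s, y ∈ Y1 ∧ y ∉ X1)}

/-- γ_ℓ^j(H2) = max over `v ∈ V2 ∪ X1 ∪ Y1` of ⌈(d_G(v)+1+ω'(v))/2⌉. -/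
noncomputable def gammaLJ [DecidableEq V] (G : SimpleGraph V) (V2 X1 Y1 : Finset V) : ℕ :=
  (V2 ∪ X1 ∪ Y1).sup fun v => (degree' G v + 1 + omegaJ G V2 X1 Y1 v + 1) / 2

/-- `(G[V2], X2, Y2)` is an antihat strip. -/
def IsAntihatStripOn (G : SimpleGraph V) (V2 X2 Y2 : Finset V) : Prop :=
  ∃ (k : ℕ) (e00 : Bool) (Xd : Finset (AHV k)) (M : Set (Sym2 (AHV k))) (f : V → AHV k),
    2 ≤ k ∧ ahA (0 : Fin (k + 1)) ∉ Xd ∧ ahB (0 : Fin (k + 1)) ∉ Xd ∧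
    (∃ i j : Fin k, i ≠ j ∧ ahC i ∉ Xd ∧ ahC j ∉ Xd) ∧
    AntihatM k e00 Xd M ∧
    IsThickeningBetween (antihatH k e00 ⊔ SimpleGraph.fromEdgeSet M) M
      ((↑Xd ∪ {ahA (0 : Fin (k + 1)), ahB (0 : Fin (k + 1))} : Set (AHV k))ᶜ)
      G (↑V2 : Set V) f ∧
    (↑X2 : Set V) = {v | v ∈ V2 ∧ ∃ i : Fin (k + 1), 1 ≤ i.val ∧ f v = ahA i ∧ ahA i ∉ Xd} ∧
    (↑Y2 : Set V) = {v | v ∈ V2 ∧ ∃ i : Fin (k + 1), 1 ≤ i.val ∧ f v = ahB i ∧ ahB i ∉ Xd} ∧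
    HasInducedW5On G (↑V2 : Set V)

/-- The base graph of strange strips, on `a1=0, a2=1, b1=2, b2=3, b3=4, c1=5, c2=6`. -/
def strangeH : SimpleGraph (Fin 7) :=
  SimpleGraph.fromEdgeSet
    {s(0, 1), s(2, 3), s(2, 4), s(3, 4), s(5, 6),
     s(0, 2), s(1, 5), s(3, 5), s(4, 5), s(0, 6), s(1, 6), s(2, 6), s(3, 6)}

/-- The matching `{b3c1, b2c2}` of strange strips. -/
def strangeM : Set (Sym2 (Fin 7)) := {s(4, 5), s(3, 6)}

/-- `(G[V2], X2, Y2)` is a strange strip. -/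
def IsStrangeStripOn (G : SimpleGraph V) (V2 X2 Y2 : Finset V) : Prop :=
  ∃ f : V → Fin 7,
    IsThickeningBetween strangeH strangeM Set.univ G (↑V2 : Set V) f ∧
    (↑X2 : Set V) = {v | v ∈ V2 ∧ (f v = 0 ∨ f v = 1)} ∧
    (↑Y2 : Set V) = {v | v ∈ V2 ∧ (f v = 2 ∨ f v = 3 ∨ f v = 4)}

/-- The base graph of gear strips, on `v1, …, v10` (as `0, …, 9`). -/
def gearH : SimpleGraph (Fin 10) :=
  SimpleGraph.fromEdgeSet
    {s(0, 1), s(1, 2), s(2, 3), s(3, 4), s(4, 5), s(0, 5),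
     s(6, 0), s(6, 1), s(6, 2), s(6, 5),
     s(7, 2), s(7, 3), s(7, 4), s(7, 5), s(7, 6),
     s(8, 0), s(8, 2), s(8, 3), s(8, 5), s(8, 6), s(8, 7),
     s(9, 1), s(9, 2), s(9, 4), s(9, 5), s(9, 6), s(9, 7)}

/-- `(G[V2], X2, Y2)` is a gear strip. -/
def IsGearStripOn (G : SimpleGraph V) (V2 X2 Y2 : Finset V) : Prop :=
  ∃ (Xd : Finset (Fin 10)) (M : Set (Sym2 (Fin 10))) (f : V → Fin 10),
    Xd ⊆ {8, 9} ∧ M ⊆ {s((6 : Fin 10), 7)} ∧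
    IsThickeningBetween gearH M ((↑Xd : Set (Fin 10))ᶜ) G (↑V2 : Set V) f ∧
    (↑X2 : Set V) = {v | v ∈ V2 ∧ (f v = 0 ∨ f v = 1)} ∧
    (↑Y2 : Set V) = {v | v ∈ V2 ∧ (f v = 3 ∨ f v = 4)}

/-! ### The two exceptional three-cliqued classes -/

/-- The base graph of Exception I, on `v1, …, v8` (as `0, …, 7`);
`b` records whether `v2v5` is an edge. -/
def exIG (b : Bool) : SimpleGraph (Fin 8) :=
  SimpleGraph.fromEdgeSet
    ({s(0, 1), s(0, 2), s(0, 5), s(0, 6), s(1, 2), s(1, 3), s(2, 3), s(2, 4), s(3, 4),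
      s(3, 5), s(4, 5), s(5, 6), s(6, 7)} ∪ (if b then {s(1, 4)} else ∅))

/-- The matching of Exception I: `{v1v4, v3v6}`, plus `v2v5` when present. -/
def exIM (b : Bool) : Set (Sym2 (Fin 8)) :=
  {s(0, 3), s(2, 5)} ∪ (if b then {s(1, 4)} else ∅)

/-- The base graph of Exception II, on `v1, …, v9` (as `0, …, 8`); `b24` records
whether `v2v4` is an edge and `b75` whether `v7v5` is an edge. -/
def exIIG (b24 b75 : Bool) : SimpleGraph (Fin 9) :=
  SimpleGraph.fromEdgeSet
    ({s(0, 1), s(6, 7),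
      s(2, 3), s(2, 4), s(2, 5), s(2, 8), s(3, 4), s(3, 5), s(3, 8), s(4, 5), s(4, 8), s(5, 8),
      s(0, 2), s(0, 7), s(0, 8), s(5, 7), s(7, 8), s(1, 2), s(5, 6)}
      ∪ (if b24 then {s(1, 3)} else ∅) ∪ (if b75 then {s(4, 6)} else ∅))

/-! ### Circular interval representations -/

/-- Membership in the (closed) arc from `s` to `t` of the circle `[0,1)`,
going in increasing direction and possibly wrapping around. -/
def ArcMem (s t x : ℝ) : Prop := if s ≤ t then s ≤ x ∧ x ≤ t else (s ≤ x ∨ x ≤ t)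

namespace Ico

/-- Sum of the values of `x` along a list. -/
def sm (x : ℕ → ℕ) : List ℕ → ℕ
  | [] => 0
  | a :: l => x a + sm x l

/-- Fibre sizes. -/
def cnt {V : Type*} (S : Finset V) (f : V → ℕ) (w : ℕ) : ℕ := (S.filter (fun v => f v = w)).card

open Classical in
/-- The closed neighbourhood inside `S`. -/
noncomputable def cn {V : Type*} (G : SimpleGraph V) (S : Finset V) (v : V) : Finset V :=
  S.filter (fun u => u = v ∨ G.Adj v u)

/-- The local bound `γ_ℓ ≤ k` on the subgraph induced by `S`. -/
def QQ {V : Type*} (G : SimpleGraph V) (S : Finset V) (k : ℕ) : Prop :=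
  ∀ v ∈ S, ∀ K : Finset V, K ⊆ S → G.IsClique (K : Set V) → v ∈ K →
    (cn G S v).card + K.card ≤ 2 * k

/-- The subgraph induced by `S` is `k`-colourable. -/
def Col {V : Type*} (G : SimpleGraph V) (S : Finset V) (k : ℕ) : Prop :=
  ∃ c : V → ℕ, (∀ v ∈ S, c v < k) ∧ ∀ u ∈ S, ∀ v ∈ S, G.Adj u v → c u ≠ c v

/-- A minimal counterexample. -/
structure MinCE {V : Type*} (G : SimpleGraph V) (S : Finset V) (k : ℕ) : Prop where
  q : QQ G S k
  nc : ¬ Col G S k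
  ih : ∀ T : Finset V, T ⊂ S → ∀ j, QQ G T j → Col G T j

/-- `f` exhibits `G[S]` as a blow-up by cliques of the graph with closed adjacency `A`
on vertex list `Ws`. -/
structure Pat {V : Type*} (G : SimpleGraph V) (S : Finset V) (A : ℕ → ℕ → Bool) (Ws : List ℕ)
    (f : V → ℕ) : Prop where
  nd : Ws.Nodup
  rf : ∀ w ∈ Ws, A w w = true
  sub : ∀ v ∈ S, f v ∈ Ws
  adj : ∀ u ∈ S, ∀ v ∈ S, u ≠ v → (G.Adj u v ↔ A (f u) (f v) = true)

section
variable {V : Type*} {G : SimpleGraph V} {S : Finset V} {k : ℕ} {A : ℕ → ℕ → Bool}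
  {Ws : List ℕ} {f : V → ℕ}

lemma card_mem (T : Finset V) (f : V → ℕ) : ∀ l : List ℕ, l.Nodup →
    (T.filter (fun v => f v ∈ l)).card = sm (cnt T f) l
  | [], _ => by simp [sm]
  | a :: l, h => by
    classical
    rw [List.nodup_cons] at h
    have := card_mem T f l h.2
    rw [sm, ← this, cnt, ← Finset.card_union_of_disjoint]
    · congr 1
      ext v
      simp only [Finset.mem_filter, Finset.mem_union, List.mem_cons]
      tauto
    · rw [Finset.disjoint_left]
      intro v hv hv'
      simp only [Finset.mem_filter] at hv hv'
      rw [hv.2] at hv'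
      exact h.1 hv'.2

lemma card_le_mem (T : Finset V) (f : V → ℕ) (l : List ℕ) (hl : l.Nodup) (K : Finset V)
    (hK : K ⊆ T) (h : ∀ v ∈ K, f v ∈ l) : K.card ≤ sm (cnt T f) l := by
  rw [← card_mem T f l hl]
  apply Finset.card_le_card
  intro v hv
  simp [hK hv, h v hv]

lemma Pat.mono (p : Pat G S A Ws f) {S' : Finset V} (h : S' ⊆ S) : Pat G S' A Ws f :=
  ⟨p.nd, p.rf, fun v hv => p.sub v (h hv), fun u hu v hv => p.adj u (h hu) v (h hv)⟩

lemma Pat.cn_card (p : Pat G S A Ws f) {v : V} (hv : v ∈ S) :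
    (cn G S v).card = sm (cnt S f) (Ws.filter (A (f v))) := by
  classical
  rw [← card_mem S f _ (p.nd.filter _)]
  congr 1
  ext u
  simp only [cn, Finset.mem_filter, List.mem_filter]
  constructor
  · rintro ⟨hu, rfl | h⟩
    · exact ⟨hu, p.sub _ hu, p.rf _ (p.sub _ hu)⟩
    · exact ⟨hu, p.sub _ hu, (p.adj v hv u hu h.ne).1 h⟩
  · rintro ⟨hu, _, h⟩
    refine ⟨hu, ?_⟩
    by_cases e : u = v
    · exact Or.inl e
    · exact Or.inr ((p.adj v hv u hu (Ne.symm e)).2 h)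

lemma Pat.del (p : Pat G S A Ws f) (w : ℕ) (h : cnt S f w = 0) :
    Pat G S A (Ws.filter (fun a => a != w)) f := by
  refine ⟨p.nd.filter _, fun a ha => p.rf a (List.mem_of_mem_filter ha), fun v hv => ?_, p.adj⟩
  rw [List.mem_filter]
  refine ⟨p.sub v hv, ?_⟩
  simp only [bne_iff_ne, ne_eq]
  rintro rfl
  rw [cnt, Finset.card_eq_zero] at h
  have : v ∈ S.filter (fun u => f u = f v) := by simp [hv]
  rw [h] at this
  simp at this

lemma cn_mono {S' : Finset V} (h : S' ⊆ S) (v : V) : cn G S' v ⊆ cn G S v := by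
  classical
  intro u hu
  simp only [cn, Finset.mem_filter] at *
  exact ⟨h hu.1, hu.2⟩

lemma QQ.mono (q : QQ G S k) {S' : Finset V} (h : S' ⊆ S) : QQ G S' k := by
  intro v hv K hK hc hvK
  have := q v (h hv) K (hK.trans h) hc hvK
  have := Finset.card_le_card (cn_mono (G := G) h v)
  omega

lemma cnt_pos_ex {w : ℕ} (h : 0 < cnt S f w) : ∃ v ∈ S, f v = w := by
  obtain ⟨v, hv⟩ := Finset.card_pos.1 h
  rw [Finset.mem_filter] at hv
  exact ⟨v, hv⟩

lemma F1v (h : MinCE G S k) {v : V} (hv : v ∈ S) : k + 1 ≤ (cn G S v).card := by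
  classical
  by_contra hlt
  apply h.nc
  obtain ⟨c, hc1, hc2⟩ := h.ih (S.erase v) (Finset.erase_ssubset hv) k
    (h.q.mono (Finset.erase_subset _ _))
  have hcard : (((cn G S v).erase v).image c).card < (Finset.range k).card := by
    have h1 : v ∈ cn G S v := by simp [cn, hv]
    have := Finset.card_erase_of_mem h1
    have h2 := Finset.card_pos.2 ⟨v, h1⟩
    have := Finset.card_image_le (s := (cn G S v).erase v) (f := c)
    rw [Finset.card_range]
    omega
  obtain ⟨a, ha, ha'⟩ := Finset.exists_mem_notMem_of_card_lt_card hcard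
  rw [Finset.mem_range] at ha
  have key : ∀ u ∈ S, G.Adj v u → c u ≠ a := by
    intro u hu hvu e
    apply ha'
    rw [Finset.mem_image]
    refine ⟨u, ?_, e⟩
    simp [cn, hu, hvu, hvu.ne']
  refine ⟨Function.update c v a, ?_, ?_⟩
  · intro u hu
    by_cases e : u = v
    · subst e; simpa using ha
    · rw [Function.update_of_ne e]; exact hc1 u (by simp [e, hu])
  · intro u hu w hw huw
    by_cases e : u = v
    · subst e
      have hwu : w ≠ u := huw.ne'
      rw [Function.update_of_ne hwu, Function.update_self]
      exact (key w hw huw).symm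
    · by_cases e' : w = v
      · subst e'
        rw [Function.update_of_ne e, Function.update_self]
        exact key u hu huw.symm
      · rw [Function.update_of_ne e, Function.update_of_ne e']
        exact hc2 u (by simp [e, hu]) w (by simp [e', hw]) huw

lemma F1 (h : MinCE G S k) (p : Pat G S A Ws f) (w : ℕ) (hw : 0 < cnt S f w) :
    k + 1 ≤ sm (cnt S f) (Ws.filter (A w)) := by
  obtain ⟨v, hv, rfl⟩ := cnt_pos_ex hw
  rw [← p.cn_card hv]
  exact F1v h hv

/-- Boolean test that a list is a duplicate-free clique. -/
def isCl (A : ℕ → ℕ → Bool) (L : List ℕ) : Bool :=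
  decide L.Nodup && L.all (fun a => L.all (fun b => A a b))

lemma F2 (h : MinCE G S k) (p : Pat G S A Ws f) (w : ℕ) (hw : 0 < cnt S f w) (L : List ℕ)
    (hL : isCl A L = true) (hwL : w ∈ L) :
    sm (cnt S f) (Ws.filter (A w)) + sm (cnt S f) L ≤ 2 * k := by
  obtain ⟨v, hv, rfl⟩ := cnt_pos_ex hw
  simp only [isCl, Bool.and_eq_true, decide_eq_true_eq, List.all_eq_true] at hL
  rw [← p.cn_card hv, ← card_mem S f L hL.1]
  apply h.q v hv _ (Finset.filter_subset _ _)
  · intro a ha b hb hab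
    simp only [Finset.coe_filter, Set.mem_ofPred_eq] at ha hb
    exact (p.adj a ha.1 b hb.1 hab).2 (hL.2 _ ha.2 _ hb.2)
  · simp [hv, hwL]

lemma MinCE.ne (h : MinCE G S k) : S.Nonempty := by
  by_contra hS
  rw [Finset.not_nonempty_iff_eq_empty] at hS
  subst hS
  exact h.nc ⟨fun _ => 0, by simp, by simp⟩

/-- multiplicity of `w` in a list of stable sets -/
def mult (Ts : List (List ℕ)) (w : ℕ) : ℕ := (Ts.filter (fun T => T.contains w)).length

/-- Boolean test for stable sets. -/
def isSt (A : ℕ → ℕ → Bool) (T : List ℕ) : Bool :=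
  T.all (fun a => T.all (fun b => a == b || !(A a b)))

lemma exR [Nonempty V] (p : Pat G S A Ws f) : ∀ Ts : List (List ℕ), (∀ T ∈ Ts, isSt A T = true) →
    (∀ w, mult Ts w ≤ cnt S f w) →
    ∃ R ⊆ S, Col G R Ts.length ∧ ∀ w, cnt R f w = mult Ts w
  | [], _, _ => by
    refine ⟨∅, by simp, ⟨fun _ => 0, by simp, by simp⟩, ?_⟩
    intro w; simp [cnt, mult]
  | T :: Ts, hT, hx => by
    classical
    have mc : ∀ w, mult (T :: Ts) w = (if w ∈ T then 1 else 0) + mult Ts w := by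
      intro w
      by_cases hw : w ∈ T
      · simp [mult, hw]; omega
      · simp [mult, hw]
    obtain ⟨R, hR, ⟨c, hc1, hc2⟩, hcnt⟩ := exR p Ts (fun T' h => hT T' (by simp [h]))
      (fun w => by have := hx w; rw [mc] at this; omega)
    have hex : ∀ w, w ∈ T → ∃ v, v ∈ S ∧ v ∉ R ∧ f v = w := by
      intro w hw
      have h1 := hx w
      rw [mc, if_pos hw, ← hcnt w] at h1
      have h2 : (R.filter (fun v => f v = w)).card < (S.filter (fun v => f v = w)).card := by
        simp only [cnt] at h1; omega
      obtain ⟨v, hv, hv'⟩ := Finset.exists_mem_notMem_of_card_lt_card h2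
      simp only [Finset.mem_filter] at hv hv'
      exact ⟨v, hv.1, fun h => hv' ⟨h, hv.2⟩, hv.2⟩
    choose! g hg1 hg2 hg3 using hex
    refine ⟨R ∪ T.toFinset.image g, ?_, ⟨fun v => if v ∈ R then c v else Ts.length, ?_, ?_⟩, ?_⟩
    · intro v hv
      rw [Finset.mem_union, Finset.mem_image] at hv
      rcases hv with h | ⟨w, hw, rfl⟩
      · exact hR h
      · exact hg1 w (by simpa using hw)
    · intro v _
      dsimp only
      split_ifs with h
      · have := hc1 v h; simp; omega
      · simp
    · intro u hu v hv huv
      have hst := hT T (by simp)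
      simp only [isSt, List.all_eq_true, Bool.or_eq_true, beq_iff_eq, Bool.not_eq_true'] at hst
      dsimp only
      by_cases h1 : u ∈ R <;> by_cases h2 : v ∈ R
      · simp only [h1, h2, if_true]; exact hc2 u h1 v h2 huv
      · simp only [h1, h2, if_true, if_false]; exact (hc1 u h1).ne
      · simp only [h1, h2, if_true, if_false]; exact (hc1 v h2).ne'
      · exfalso
        simp only [Finset.mem_union, h1, h2, false_or, Finset.mem_image, List.mem_toFinset] at hu hv
        obtain ⟨a, ha, rfl⟩ := hu
        obtain ⟨b, hb, rfl⟩ := hv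
        have h3 := (p.adj _ (hg1 a ha) _ (hg1 b hb) huv.ne).1 huv
        rw [hg3 a ha, hg3 b hb] at h3
        rcases hst a ha b hb with rfl | h4
        · exact huv.ne rfl
        · rw [h3] at h4; cases h4
    · intro w
      rw [mc, ← hcnt w]
      simp only [cnt]
      rw [Finset.filter_union, Finset.card_union_of_disjoint, add_comm]
      · congr 1
        split_ifs with hw
        · rw [Finset.card_eq_one]
          refine ⟨g w, ?_⟩
          ext v
          simp only [Finset.mem_filter, Finset.mem_image, List.mem_toFinset, Finset.mem_singleton]
          constructor
          · rintro ⟨⟨a, ha, rfl⟩, h⟩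
            rw [hg3 a ha] at h; rw [h]
          · rintro rfl; exact ⟨⟨w, hw, rfl⟩, hg3 w hw⟩
        · rw [Finset.card_eq_zero, Finset.filter_eq_empty_iff]
          intro v hv
          simp only [Finset.mem_image, List.mem_toFinset] at hv
          obtain ⟨a, ha, rfl⟩ := hv
          rw [hg3 a ha]; rintro rfl; exact hw ha
      · rw [Finset.disjoint_left]
        intro v hv hv'
        simp only [Finset.mem_filter, Finset.mem_image, List.mem_toFinset] at hv hv'
        obtain ⟨⟨a, ha, rfl⟩, _⟩ := hv'
        exact hg2 a ha hv.1

/-- Checks that every clique inside `ws` (joined to the chosen clique `K`) lies in a member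
of `CL`. -/
def cov (A : ℕ → ℕ → Bool) (CL : List (List ℕ)) : List ℕ → List ℕ → Bool
  | [], K => CL.any (fun L => K.all (fun a => L.contains a))
  | w :: ws, K => cov A CL ws K && (!(K.all (fun a => A w a)) || cov A CL ws (w :: K))

lemma cov_sound (CL : List (List ℕ)) (P : ℕ → Prop)
    (hP : ∀ a b, P a → P b → A a b = true) : ∀ (ws K : List ℕ), cov A CL ws K = true →
    (∀ a ∈ K, P a) → ∃ L ∈ CL, ∀ a, (a ∈ K ∨ a ∈ ws) → P a → a ∈ L
  | [], K, h, _ => by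
    simp only [cov, List.any_eq_true, List.all_eq_true, List.contains_iff_mem] at h
    obtain ⟨L, hL, h⟩ := h
    refine ⟨L, hL, fun a ha _ => ?_⟩
    simp only [List.not_mem_nil, or_false] at ha
    exact h a ha
  | w :: ws, K, h, hK => by
    simp only [cov, Bool.and_eq_true, Bool.or_eq_true] at h
    by_cases hw : P w
    · have h2 : cov A CL ws (w :: K) = true := by
        rcases h.2 with h2 | h2
        · exfalso
          rw [Bool.not_eq_true', ← Bool.not_eq_true] at h2
          apply h2
          rw [List.all_eq_true]
          intro a ha
          exact hP _ _ hw (hK a ha)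
        · exact h2
      obtain ⟨L, hL, h3⟩ := cov_sound CL P hP ws (w :: K) h2 (by
        intro a ha
        rw [List.mem_cons] at ha
        rcases ha with rfl | ha
        · exact hw
        · exact hK a ha)
      refine ⟨L, hL, fun a ha hPa => h3 a ?_ hPa⟩
      simp only [List.mem_cons] at ha ⊢
      tauto
    · obtain ⟨L, hL, h3⟩ := cov_sound CL P hP ws K h.1 hK
      refine ⟨L, hL, fun a ha hPa => h3 a ?_ hPa⟩
      simp only [List.mem_cons] at ha
      rcases ha with ha | rfl | ha
      · exact Or.inl ha
      · exact absurd hPa hw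
      · exact Or.inr ha

/-- List of potential violations after removing the stable sets `Ts`: entries are
(vertex, closed neighbourhood, clique, decrease). -/
def viol (A : ℕ → ℕ → Bool) (Ws : List ℕ) (CL Ts : List (List ℕ)) :
    List (ℕ × List ℕ × List ℕ × ℕ) :=
  (Ws.flatMap (fun w => (CL.filter (fun L => L.contains w)).map (fun L =>
    (w, Ws.filter (A w), L, sm (mult Ts) (Ws.filter (A w)) + sm (mult Ts) L)))).filter
    (fun p => decide (p.2.2.2 < 2 * Ts.length))

/-- All side conditions of the reduction step. -/
def okR (A : ℕ → ℕ → Bool) (Ws : List ℕ) (CL Ts : List (List ℕ)) : Bool :=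
  cov A CL Ws [] && CL.all (isCl A) && Ts.all (isSt A) && Ts.any (fun T => !T.isEmpty)

lemma sm_add (x y : ℕ → ℕ) : ∀ l : List ℕ, sm (fun w => x w + y w) l = sm x l + sm y l
  | [] => rfl
  | a :: l => by simp only [sm, sm_add x y l]; omega

lemma F3 (h : MinCE G S k) (p : Pat G S A Ws f) (CL Ts : List (List ℕ))
    (hok : okR A Ws CL Ts = true) (hk : Ts.length ≤ k)
    (hx : ∀ w ∈ Ts.flatten, mult Ts w ≤ cnt S f w) :
    ∃ q ∈ viol A Ws CL Ts, mult Ts q.1 < cnt S f q.1 ∧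
      2 * k + q.2.2.2 + 1 ≤ sm (cnt S f) q.2.1 + sm (cnt S f) q.2.2.1 + 2 * Ts.length := by
  classical
  simp only [okR, Bool.and_eq_true] at hok
  obtain ⟨⟨⟨hcov, hCL⟩, hSt⟩, hne⟩ := hok
  rw [List.all_eq_true] at hSt hCL
  have hx' : ∀ w, mult Ts w ≤ cnt S f w := by
    intro w
    by_cases hw : w ∈ Ts.flatten
    · exact hx w hw
    · have : mult Ts w = 0 := by
        rw [mult, List.length_eq_zero_iff, List.filter_eq_nil_iff]
        intro T hT hc
        rw [List.contains_iff_mem] at hc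
        exact hw (List.mem_flatten.2 ⟨T, hT, hc⟩)
      omega
  haveI : Nonempty V := ⟨h.ne.choose⟩
  obtain ⟨R, hRS, ⟨c, hc1, hc2⟩, hcnt⟩ := exR p Ts hSt hx'
  have hsplit : ∀ w, cnt S f w = cnt (S \ R) f w + mult Ts w := by
    intro w
    rw [← hcnt w]
    simp only [cnt]
    rw [← Finset.card_union_of_disjoint, ← Finset.filter_union,
      Finset.sdiff_union_of_subset hRS]
    exact Finset.disjoint_filter_filter Finset.sdiff_disjoint
  have hsub : S \ R ⊂ S := by
    refine Finset.ssubset_iff_subset_ne.2 ⟨Finset.sdiff_subset, ?_⟩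
    intro e
    rw [List.any_eq_true] at hne
    obtain ⟨T, hT, hT'⟩ := hne
    cases T with
    | nil => simp at hT'
    | cons w T =>
      have h1 := hsplit w
      rw [e] at h1
      have : 0 < mult Ts w := by
        rw [mult, List.length_pos_iff_exists_mem]
        exact ⟨w :: T, by simp [hT]⟩
      omega
  have hnQ : ¬ QQ G (S \ R) (k - Ts.length) := by
    intro hQ
    obtain ⟨d, hd1, hd2⟩ := h.ih _ hsub _ hQ
    apply h.nc
    refine ⟨fun v => if v ∈ R then c v else d v + Ts.length, ?_, ?_⟩
    · intro v hv
      dsimp only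
      split_ifs with hvR
      · have := hc1 v hvR; omega
      · have := hd1 v (by simp [hv, hvR]); omega
    · intro u hu v hv huv
      dsimp only
      by_cases h1 : u ∈ R <;> by_cases h2 : v ∈ R
      · simp only [h1, h2, if_true]; exact hc2 u h1 v h2 huv
      · simp only [h1, h2, if_true, if_false]; have := hc1 u h1; omega
      · simp only [h1, h2, if_true, if_false]; have := hc1 v h2; omega
      · simp only [h1, h2, if_false]
        have := hd2 u (by simp [hu, h1]) v (by simp [hv, h2]) huv
        omega
  simp only [QQ, not_forall, not_le] at hnQ
  obtain ⟨v, hv, K, hK, hKc, hvK, hlt⟩ := hnQ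
  have p' := p.mono (Finset.sdiff_subset (s := S) (t := R))
  obtain ⟨L, hL, hKL⟩ := cov_sound (A := A) CL (fun a => ∃ u ∈ K, f u = a) (by
    rintro a b ⟨u, hu, rfl⟩ ⟨u', hu', rfl⟩
    by_cases e : u = u'
    · subst e; exact p'.rf _ (p'.sub _ (hK hu))
    · exact (p'.adj u (hK hu) u' (hK hu') e).1 (hKc hu hu' e)) Ws [] hcov (by simp)
  have hKL' : ∀ u ∈ K, f u ∈ L := fun u hu => hKL _ (Or.inr (p'.sub _ (hK hu))) ⟨u, hu, rfl⟩
  have hLc := hCL L hL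
  have hLn : L.Nodup := by
    simp only [isCl, Bool.and_eq_true, decide_eq_true_eq] at hLc
    exact hLc.1
  have hK2 := card_le_mem (S \ R) f L hLn K hK hKL'
  rw [p'.cn_card hv] at hlt
  have hfun : cnt S f = fun w => cnt (S \ R) f w + mult Ts w := funext hsplit
  have e1 : sm (cnt S f) (Ws.filter (A (f v))) =
      sm (cnt (S \ R) f) (Ws.filter (A (f v))) + sm (mult Ts) (Ws.filter (A (f v))) := by
    rw [hfun, sm_add]
  have e2 : sm (cnt S f) L = sm (cnt (S \ R) f) L + sm (mult Ts) L := by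
    rw [hfun, sm_add]
  have hpos : mult Ts (f v) < cnt S f (f v) := by
    rw [hsplit]
    have : 0 < cnt (S \ R) f (f v) := Finset.card_pos.2 ⟨v, Finset.mem_filter.2 ⟨hv, rfl⟩⟩
    omega
  have f2 := F2 h p (f v) (by omega) L hLc (hKL' v hvK)
  refine ⟨(f v, Ws.filter (A (f v)), L,
    sm (mult Ts) (Ws.filter (A (f v))) + sm (mult Ts) L), ?_, hpos, ?_⟩
  · rw [viol, List.mem_filter]
    constructor
    · rw [List.mem_flatMap]
      refine ⟨f v, p'.sub v hv, ?_⟩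
      rw [List.mem_map]
      exact ⟨L, by simp [hL, hKL' v hvK], rfl⟩
    · simp only [decide_eq_true_eq]
      omega
  · dsimp only
    omega

/-- Relabelling a pattern. -/
lemma Pat.remap (p : Pat G S A Ws f) (φ : ℕ → ℕ) (A' : ℕ → ℕ → Bool) (Ws' : List ℕ)
    (hnd : Ws'.Nodup) (hrf : ∀ w ∈ Ws', A' w w = true) (hφ : ∀ w ∈ Ws, φ w ∈ Ws')
    (hA : ∀ a ∈ Ws, ∀ b ∈ Ws, A a b = A' (φ a) (φ b)) :
    Pat G S A' Ws' (fun v => φ (f v)) :=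
  ⟨hnd, hrf, fun v hv => hφ _ (p.sub v hv), fun u hu v hv huv => by
    rw [p.adj u hu v hv huv, hA _ (p.sub u hu) _ (p.sub v hv)]⟩

lemma remap_pos (φ : ℕ → ℕ) {a : ℕ} (b : ℕ) (h : 0 < cnt S f a) (hb : φ a = b) :
    0 < cnt S (fun v => φ (f v)) b := by
  obtain ⟨v, hv, rfl⟩ := cnt_pos_ex h
  exact Finset.card_pos.2 ⟨v, by simp [hv, hb]⟩

lemma MinCE.twok (h : MinCE G S k) : 2 ≤ k := by
  obtain ⟨v, hv⟩ := h.ne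
  have h1 := F1v h hv
  have h2 := h.q v hv {v} (by simpa using hv) (by simp) (by simp)
  simp at h2
  omega

/-- If there is no minimal counterexample with a given pattern, the bound holds. -/
lemma no_ce (hno : ∀ (S : Finset V) (k : ℕ), MinCE G S k → Pat G S A Ws f → False) :
    ∀ (S : Finset V) (k : ℕ), Pat G S A Ws f → QQ G S k → Col G S k := by
  intro S
  induction S using Finset.strongInduction with
  | H S ih =>
    intro k p q
    by_contra hc
    exact hno S k ⟨q, hc, fun S' hS' k' q' => ih S' hS' k' (p.mono hS'.1) q'⟩ p

end
end Ico

namespace Ico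
section

/-- A linear fact `a k + c + x(l) ≤ b k + d + x(r)`. -/
structure Fact where
  a : ℕ
  c : ℕ
  l : List ℕ
  b : ℕ
  d : ℕ
  r : List ℕ

/-- Truth of a linear fact. -/
def Fact.holds (F : Fact) (x : ℕ → ℕ) (k : ℕ) : Prop :=
  F.a * k + F.c + sm x F.l ≤ F.b * k + F.d + sm x F.r

/-- References to available facts: degree bound, degree/clique bound, lower bound, extra fact. -/
inductive Ref where
  | n (w : ℕ)
  | q (w : ℕ) (L : List ℕ)
  | p (w : ℕ)
  | e (i : ℕ)

/-- Proof trees for the finite case analysis. -/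
inductive Tree where
  | leaf (c : List (ℕ × Ref))
  | split (w : ℕ) (t0 t1 : Tree)
  | red (Ts : List (List ℕ)) (t : Tree)
  | br (t1 t2 : Tree)
  | nil
  | use (i : ℕ) (m : List (ℕ × ℕ))

/-- Closed neighbourhoods in the three base graphs: the split version of `G2`, the icosahedron,
and the five-cycle. -/
def nb : ℕ → ℕ → List ℕ
  | 0, 0 => [0, 1, 3, 5, 7, 9, 11, 19]
  | 0, 1 => [0, 1, 2, 3, 4, 9, 11, 19]
  | 0, 2 => [1, 2, 3, 4, 11, 14]
  | 0, 3 => [0, 1, 2, 3, 4, 5, 11, 14]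
  | 0, 4 => [1, 2, 3, 4, 5, 6, 14, 16]
  | 0, 5 => [0, 3, 4, 5, 6, 7, 14, 16]
  | 0, 6 => [4, 5, 6, 7, 8, 9, 14, 16]
  | 0, 7 => [0, 5, 6, 7, 8, 9, 16, 19]
  | 0, 8 => [6, 7, 8, 9, 16, 19]
  | 0, 9 => [0, 1, 6, 7, 8, 9, 11, 19]
  | 0, 11 => [0, 1, 2, 3, 9, 11, 19]
  | 0, 14 => [2, 3, 4, 5, 6, 14, 16]
  | 0, 16 => [4, 5, 6, 7, 8, 14, 16]
  | 0, 19 => [0, 1, 7, 8, 9, 11, 19]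
  | 1, 0 => [0, 1, 3, 5, 7, 9]
  | 1, 1 => [0, 1, 2, 3, 9, 10]
  | 1, 2 => [1, 2, 3, 4, 10, 11]
  | 1, 3 => [0, 1, 2, 3, 4, 5]
  | 1, 4 => [2, 3, 4, 5, 6, 11]
  | 1, 5 => [0, 3, 4, 5, 6, 7]
  | 1, 6 => [4, 5, 6, 7, 8, 11]
  | 1, 7 => [0, 5, 6, 7, 8, 9]
  | 1, 8 => [6, 7, 8, 9, 10, 11]
  | 1, 9 => [0, 1, 7, 8, 9, 10]
  | 1, 10 => [1, 2, 8, 9, 10, 11]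
  | 1, 11 => [2, 4, 6, 8, 10, 11]
  | 2, 0 => [0, 1, 4]
  | 2, 1 => [0, 1, 2]
  | 2, 2 => [1, 2, 3]
  | 2, 3 => [2, 3, 4]
  | 2, 4 => [0, 3, 4]
  | _, _ => []

/-- Closed adjacency of the base graphs. -/
def AA (g a b : ℕ) : Bool := (nb g a).contains b

/-- Maximal cliques of the base graphs. -/
def CC : ℕ → List (List ℕ)
  | 0 => [[0, 1, 3, 11], [0, 1, 9, 11, 19], [0, 3, 5], [0, 5, 7], [0, 7, 9, 19],
      [1, 2, 3, 4], [1, 2, 3, 11], [2, 3, 4, 14], [3, 4, 5, 14], [4, 5, 6, 14, 16],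
      [5, 6, 7, 16], [6, 7, 8, 9], [6, 7, 8, 16], [7, 8, 9, 19]]
  | 1 => [[0, 1, 3], [0, 1, 9], [0, 3, 5], [0, 5, 7], [0, 7, 9], [1, 2, 3], [1, 2, 10],
      [1, 9, 10], [2, 3, 4], [2, 4, 11], [2, 10, 11], [3, 4, 5], [4, 5, 6], [4, 6, 11],
      [5, 6, 7], [6, 7, 8], [6, 8, 11], [7, 8, 9], [8, 9, 10], [8, 10, 11]]
  | _ => [[0, 1], [1, 2], [2, 3], [3, 4], [0, 4]]

/-- Restrict a clique list to `Ws` and drop dominated members. -/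
def rs (Ws : List ℕ) (CL : List (List ℕ)) : List (List ℕ) :=
  let R := (CL.map (fun L => L.filter (fun a => Ws.contains a))).dedup
  R.filter (fun L => !(R.any (fun K => L != K && L.all (fun a => K.contains a))))

/-- Trivial fact. -/
def tf : Fact := ⟨0, 0, [], 0, 0, []⟩

/-- Look up a fact. -/
def getF (g : ℕ) (Ws P : List ℕ) (E : List Fact) : Ref → Fact
  | .n w => if P.contains w then ⟨1, 1, [], 0, 0, Ws.filter (AA g w)⟩ else tf
  | .q w L => if P.contains w && L.contains w && isCl (AA g) L then
      ⟨0, 0, Ws.filter (AA g w) ++ L, 2, 0, []⟩ else tf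
  | .p w => ⟨0, P.count w, [], 0, 0, [w]⟩
  | .e i => E.getD i tf

/-- Concatenate `m` copies. -/
def rep : ℕ → List ℕ → List ℕ
  | 0, _ => []
  | m + 1, l => l ++ rep m l

/-- Linear combination of facts. -/
def comb (g : ℕ) (Ws P : List ℕ) (E : List Fact) : List (ℕ × Ref) → Fact
  | [] => tf
  | (m, R) :: c =>
    let F := getF g Ws P E R
    let C := comb g Ws P E c
    ⟨m * F.a + C.a, m * F.c + C.c, rep m F.l ++ C.l, m * F.b + C.b, m * F.d + C.d,
      rep m F.r ++ C.r⟩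

/-- The fact is contradictory. -/
def contra (F : Fact) : Bool :=
  decide (F.b ≤ F.a) && decide (F.d < F.c) &&
    F.r.all (fun w => decide (F.r.count w ≤ F.l.count w))

/-- Apply a finite relabelling. -/
def app (m : List (ℕ × ℕ)) (w : ℕ) : ℕ := (m.lookup w).getD w

/-- Side conditions of a reduction by stable sets. -/
def okR2 (g : ℕ) (Ws P : List ℕ) (CL Ts : List (List ℕ)) : Bool :=
  okR (AA g) Ws CL Ts && Ts.flatten.all (fun w => decide (mult Ts w ≤ P.count w)) &&
  Ts.flatten.any (fun w => CL.any (fun L => L.contains w &&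
    decide (2 * Ts.length ≤ sm (mult Ts) (Ws.filter (AA g w)) + sm (mult Ts) L)))

/-- Side conditions for quoting an earlier configuration. -/
def okU (g : ℕ) (Ws P : List ℕ) (m : List (ℕ × ℕ)) (e : ℕ × List ℕ × List ℕ) : Bool :=
  decide e.2.1.Nodup && e.2.1.all (fun w => AA e.1 w w) &&
  Ws.all (fun w => e.2.1.contains (app m w)) &&
  Ws.all (fun a => Ws.all (fun b => AA g a b == AA e.1 (app m a) (app m b))) &&
  decide e.2.2.Nodup && e.2.2.all (fun w => (P.map (app m)).contains w)

/-- The proof checker. -/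
def chk (env : List (ℕ × List ℕ × List ℕ)) (g : ℕ) : Tree → List ℕ → List ℕ → List Fact →
    Option (List (List ℕ × Fact)) → Bool
  | .leaf c, Ws, P, E, _ => Ws.isEmpty || contra (comb g Ws P E c)
  | .split w t0 t1, Ws, P, E, _ =>
    chk env g t0 (if P.contains w then Ws else Ws.filter (fun a => a != w)) P
      (E ++ [⟨0, 0, [w], 0, P.count w, []⟩]) none &&
    chk env g t1 Ws (w :: P) E none
  | .red Ts t, Ws, P, E, _ =>
    okR2 g Ws P (rs Ws (CC g)) Ts &&
    chk env g t Ws P E (some ((viol (AA g) Ws (rs Ws (CC g)) Ts).map (fun q =>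
      (List.replicate (mult Ts q.1 + 1 - P.count q.1) q.1,
        ⟨2, q.2.2.2 + 1, [], 0, 2 * Ts.length, q.2.1 ++ q.2.2.1⟩))))
  | .br t1 t2, Ws, P, E, D =>
    match D with
    | some (d :: D') => chk env g t1 Ws (d.1 ++ P) (E ++ [d.2]) none &&
        chk env g t2 Ws P E (some D')
    | _ => false
  | .nil, _, _, _, D =>
    match D with
    | some [] => true
    | _ => false
  | .use i m, Ws, P, _, _ =>
    match env[i]? with
    | some e => okU g Ws P m e
    | none => false

lemma sm_append (x : ℕ → ℕ) : ∀ l l' : List ℕ, sm x (l ++ l') = sm x l + sm x l'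
  | [], l' => by simp [sm]
  | a :: l, l' => by
    have := sm_append x l l'
    simp only [List.cons_append, sm, this]
    omega

lemma sm_rep (x : ℕ → ℕ) (l : List ℕ) : ∀ m : ℕ, sm x (rep m l) = m * sm x l
  | 0 => by simp [rep, sm]
  | m + 1 => by rw [rep, sm_append, sm_rep x l m]; ring

lemma sm_perm (x : ℕ → ℕ) {l l' : List ℕ} (h : l.Perm l') : sm x l = sm x l' := by
  induction h with
  | nil => rfl
  | cons a _ ih => simp only [sm, ih]
  | swap a b l => simp only [sm]; omega
  | trans _ _ h1 h2 => exact h1.trans h2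

lemma sm_sub (x : ℕ → ℕ) {l l' : List ℕ} (h : l.Sublist l') : sm x l ≤ sm x l' := by
  induction h with
  | slnil => exact le_rfl
  | cons a _ ih => simp only [sm]; omega
  | cons_cons a _ ih => simp only [sm]; omega

lemma sm_mono {x y : ℕ → ℕ} (h : ∀ w, x w ≤ y w) : ∀ l, sm x l ≤ sm y l
  | [] => le_rfl
  | a :: l => by have := sm_mono h l; have := h a; simp only [sm]; omega

lemma sm_count (x : ℕ → ℕ) {r l : List ℕ} (h : ∀ w ∈ r, r.count w ≤ l.count w) :
    sm x r ≤ sm x l := by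
  obtain ⟨r', hp, hs⟩ := List.subperm_ext_iff.2 h
  rw [← sm_perm x hp]
  exact sm_sub x hs

lemma contra_sound {F : Fact} (h : contra F = true) {x : ℕ → ℕ} {k : ℕ} (hF : F.holds x k) :
    False := by
  simp only [contra, Bool.and_eq_true, decide_eq_true_eq, List.all_eq_true] at h
  obtain ⟨⟨h1, h2⟩, h3⟩ := h
  have h4 := sm_count x h3
  have h5 := Nat.mul_le_mul_right k h1
  unfold Fact.holds at hF
  omega

variable {V : Type*} {G : SimpleGraph V}

/-- A configuration which admits no minimal counterexample. -/
def Refuted (G : SimpleGraph V) (e : ℕ × List ℕ × List ℕ) : Prop :=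
  ∀ (S : Finset V) (k : ℕ) (f : V → ℕ), MinCE G S k → Pat G S (AA e.1) e.2.1 f →
    (∀ w, e.2.2.count w ≤ cnt S f w) → False

lemma getF_sound {S : Finset V} {k : ℕ} {f : V → ℕ} {g : ℕ} {Ws P : List ℕ} {E : List Fact}
    (h : MinCE G S k) (p : Pat G S (AA g) Ws f) (hP : ∀ w, P.count w ≤ cnt S f w)
    (hE : ∀ F ∈ E, F.holds (cnt S f) k) (R : Ref) : (getF g Ws P E R).holds (cnt S f) k := by
  have htf : tf.holds (cnt S f) k := by simp [tf, Fact.holds, sm]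
  have hpos : ∀ w, w ∈ P → 0 < cnt S f w := fun w hw =>
    lt_of_lt_of_le (List.count_pos_iff.2 hw) (hP w)
  cases R with
  | n w =>
    simp only [getF]
    split_ifs with hw
    · have := F1 h p w (hpos w (by simpa using hw))
      simp only [Fact.holds, sm]
      omega
    · exact htf
  | q w L =>
    simp only [getF]
    split_ifs with hw
    · simp only [Bool.and_eq_true, List.contains_iff_mem] at hw
      have := F2 h p w (hpos w hw.1.1) L hw.2 hw.1.2
      simp only [Fact.holds, sm, sm_append]
      omega
    · exact htf
  | p w =>
    have := hP w
    simp only [getF, Fact.holds, sm]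
    omega
  | e i =>
    simp only [getF, List.getD_eq_getElem?_getD]
    cases hi : E[i]? with
    | none => simpa using htf
    | some F => exact hE F (List.mem_of_getElem? hi)

lemma comb_sound {S : Finset V} {k : ℕ} {f : V → ℕ} {g : ℕ} {Ws P : List ℕ} {E : List Fact}
    (h : MinCE G S k) (p : Pat G S (AA g) Ws f) (hP : ∀ w, P.count w ≤ cnt S f w)
    (hE : ∀ F ∈ E, F.holds (cnt S f) k) :
    ∀ c : List (ℕ × Ref), (comb g Ws P E c).holds (cnt S f) k
  | [] => by simp [comb, tf, Fact.holds, sm]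
  | (m, R) :: c => by
    have h1 := getF_sound h p hP hE R
    have h2 := comb_sound h p hP hE c
    have h3 := Nat.mul_le_mul_left m h1
    simp only [comb, Fact.holds, sm_append, sm_rep] at *
    nlinarith

lemma chk_sound (env : List (ℕ × List ℕ × List ℕ)) (henv : ∀ e ∈ env, Refuted G e) (g : ℕ)
    {S : Finset V} {k : ℕ} {f : V → ℕ} (h : MinCE G S k) :
    ∀ (t : Tree) (Ws P : List ℕ) (E : List Fact) (D : Option (List (List ℕ × Fact))),
    chk env g t Ws P E D = true → Pat G S (AA g) Ws f → (∀ w, P.count w ≤ cnt S f w) →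
    (∀ F ∈ E, F.holds (cnt S f) k) →
    (∀ D', D = some D' → ∃ d ∈ D', (∀ w, (d.1 ++ P).count w ≤ cnt S f w) ∧
      d.2.holds (cnt S f) k) → False := by
  intro t
  induction t with
  | leaf c =>
    intro Ws P E D hc p hP hE _
    simp only [chk, Bool.or_eq_true, List.isEmpty_iff] at hc
    rcases hc with rfl | hc
    · obtain ⟨v, hv⟩ := h.ne
      have := p.sub v hv
      simp at this
    · exact contra_sound hc (comb_sound h p hP hE c)
  | split w t0 t1 ih0 ih1 =>
    intro Ws P E D hc p hP hE _
    simp only [chk, Bool.and_eq_true] at hc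
    by_cases hw : cnt S f w = P.count w
    · refine ih0 _ _ _ _ hc.1 ?_ hP ?_ (by simp)
      · split_ifs with hPw
        · exact p
        · apply p.del
          rw [hw, List.count_eq_zero]
          simpa using hPw
      · intro F hF
        rw [List.mem_append, List.mem_singleton] at hF
        rcases hF with hF | rfl
        · exact hE F hF
        · simp only [Fact.holds, sm]; omega
    · refine ih1 _ _ _ _ hc.2 p ?_ hE (by simp)
      intro a
      have := hP a
      have := hP w
      rw [List.count_cons]
      split_ifs with e
      · rw [beq_iff_eq] at e; subst e; omega
      · omega
  | red Ts t ih =>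
    intro Ws P E D hc p hP hE _
    simp only [chk, Bool.and_eq_true] at hc
    obtain ⟨hok, hc⟩ := hc
    refine ih _ _ _ _ hc p hP hE ?_
    rintro D' hD'
    injection hD' with hD'
    subst hD'
    simp only [okR2, Bool.and_eq_true, List.all_eq_true, decide_eq_true_eq, List.any_eq_true,
      List.contains_iff_mem] at hok
    obtain ⟨⟨hok, hm⟩, w, hw, L, hL, hwL, h2⟩ := hok
    have hx : ∀ w ∈ Ts.flatten, mult Ts w ≤ cnt S f w := fun w hw => (hm w hw).trans (hP w)
    have hx' : ∀ w, mult Ts w ≤ cnt S f w := by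
      intro w
      by_cases hw : w ∈ Ts.flatten
      · exact hx w hw
      · have : mult Ts w = 0 := by
          rw [mult, List.length_eq_zero_iff, List.filter_eq_nil_iff]
          intro T hT hc
          rw [List.contains_iff_mem] at hc
          exact hw (List.mem_flatten.2 ⟨T, hT, hc⟩)
        omega
    have hwpos : 0 < cnt S f w := by
      refine lt_of_lt_of_le ?_ (hx w hw)
      obtain ⟨T, hT, hwT⟩ := List.mem_flatten.1 hw
      rw [mult, List.length_pos_iff_exists_mem]
      exact ⟨T, by simp [hT, hwT]⟩
    have hLc : isCl (AA g) L = true := by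
      simp only [okR, Bool.and_eq_true, List.all_eq_true] at hok
      exact hok.1.1.2 L hL
    have hF2 := F2 h p w hwpos L hLc hwL
    have m1 := sm_mono hx' L
    have m2 := sm_mono hx' (Ws.filter (AA g w))
    obtain ⟨q, hq, hq1, hq2⟩ := F3 h p _ Ts hok (by omega) hx
    refine ⟨_, List.mem_map.2 ⟨q, hq, rfl⟩, ?_, ?_⟩
    · intro a
      have := hP a
      rw [List.count_append, List.count_replicate]
      split_ifs with e
      · rw [beq_iff_eq] at e; subst e; omega
      · omega
    · simp only [Fact.holds, sm, sm_append]; omega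
  | br t1 t2 ih1 ih2 =>
    intro Ws P E D hc p hP hE hD
    match D, hc, hD with
    | some (d :: D'), hc, hD =>
      simp only [chk, Bool.and_eq_true] at hc
      obtain ⟨d', hd', h1, h2⟩ := hD _ rfl
      rw [List.mem_cons] at hd'
      rcases hd' with rfl | hd'
      · refine ih1 _ _ _ _ hc.1 p h1 ?_ (by simp)
        intro F hF
        rw [List.mem_append, List.mem_singleton] at hF
        rcases hF with hF | rfl
        · exact hE F hF
        · exact h2
      · refine ih2 _ _ _ _ hc.2 p hP hE ?_
        rintro D'' hD''
        injection hD'' with hD''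
        subst hD''
        exact ⟨d', hd', h1, h2⟩
    | some [], hc, _ => simp [chk] at hc
    | none, hc, _ => simp [chk] at hc
  | nil =>
    intro Ws P E D hc p hP hE hD
    match D, hc, hD with
    | some (d :: D'), hc, hD => simp [chk] at hc
    | some [], hc, hD => obtain ⟨d, hd, _⟩ := hD _ rfl; simp at hd
    | none, hc, _ => simp [chk] at hc
  | use i m =>
    intro Ws P E D hc p hP hE _
    simp only [chk] at hc
    cases hi : env[i]? with
    | none => rw [hi] at hc; cases hc
    | some e =>
      rw [hi] at hc
      simp only [okU, Bool.and_eq_true, List.all_eq_true, decide_eq_true_eq,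
        List.contains_iff_mem, beq_iff_eq] at hc
      obtain ⟨⟨⟨⟨⟨h1, h2⟩, h3⟩, h4⟩, h5⟩, h6⟩ := hc
      refine henv e (List.mem_of_getElem? hi) S k _ h (p.remap (app m) _ _ h1 h2 h3 h4) ?_
      intro w
      by_cases hw : w ∈ e.2.2
      · rw [List.count_eq_one_of_mem h5 hw]
        obtain ⟨a, ha, e'⟩ := List.mem_map.1 (h6 w hw)
        exact remap_pos (app m) w (lt_of_lt_of_le (List.count_pos_iff.2 ha) (hP a)) e'
      · rw [List.count_eq_zero.2 hw]; exact Nat.zero_le _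

lemma refute (env : List (ℕ × List ℕ × List ℕ)) (henv : ∀ e ∈ env, Refuted G e)
    (e : ℕ × List ℕ × List ℕ) (t : Tree) (hc : chk env e.1 t e.2.1 e.2.2 [] none = true) :
    Refuted G e := by
  intro S k f h p hP
  exact chk_sound env henv e.1 h t _ _ _ _ hc p hP (by simp) (by simp)

lemma env_cons {env : List (ℕ × List ℕ × List ℕ)} {e : ℕ × List ℕ × List ℕ}
    (h : Refuted G e) (henv : ∀ e ∈ env, Refuted G e) : ∀ e' ∈ e :: env, Refuted G e' := by
  intro e' he'
  rw [List.mem_cons] at he'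
  rcases he' with rfl | h'
  · exact h
  · exact henv _ h'

end
end Ico

namespace Ico

/-- Proof tree for configuration `c5`. -/
def tr_c5 : Tree :=
  .split 0 (.split 1 (.split 2 (.split 3 (.split 4 (.leaf []) (.leaf [(2, .n 4), (1, .q 4
  [4])])) (.leaf [(2, .n 3), (1, .q 3 [3, 4])])) (.leaf [(2, .n 2), (1, .q 2 [2, 3])])) (.leaf
  [(2, .n 1), (1, .q 1 [1, 2])])) (.split 1 (.leaf [(2, .n 0), (1, .q 0 [0, 4])]) (.split 2
  (.leaf [(2, .n 1), (1, .q 1 [0, 1])]) (.split 3 (.leaf [(2, .n 2), (1, .q 1 [1, 2]), (1, .p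
  0)]) (.split 4 (.leaf [(1, .p 2), (1, .q 1 [0, 1]), (2, .n 0)]) (.split 0 (.leaf [(2, .n 4),
  (1, .q 4 [0, 4]), (1, .q 2 [1, 2]), (2, .n 1), (2, .e 0)]) (.split 1 (.leaf [(4, .n 0), (1, .p
  0), (2, .q 4 [0, 4]), (2, .n 2), (1, .q 1 [1, 2]), (4, .e 0)]) (.split 2 (.leaf [(1, .p 0),
  (1, .q 4 [3, 4]), (2, .n 3), (2, .e 0)]) (.split 3 (.leaf [(1, .p 1), (1, .q 0 [0, 4]), (2, .n
  4), (2, .e 0)]) (.split 4 (.leaf [(2, .n 3), (1, .q 2 [2, 3]), (1, .p 1), (2, .e 0)]) (.red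
  [[0, 2], [1, 3], [2, 4], [0, 3], [1, 4]] (.nil)))))))))))

/-- Configuration `c5`. -/
def cf_c5 : ℕ × List ℕ × List ℕ := (2, [0, 1, 2, 3, 4], [])

/-- Proof tree for configuration `j8a`. -/
def tr_j8a : Tree :=
  .split 5 (.use 0 [(3, 1), (4, 2), (6, 3), (7, 4), (9, 4)]) (.split 0 (.split 9 (.red [[5]]
  (.nil)) (.red [[5, 9]] (.nil))) (.split 9 (.red [[5]] (.nil)) (.red [[5, 9]] (.nil))))

/-- Configuration `j8a`. -/
def cf_j8a : ℕ × List ℕ × List ℕ := (0, [0, 3, 4, 5, 6, 7, 9], [])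

/-- Proof tree for configuration `j8b`. -/
def tr_j8b : Tree :=
  .split 3 (.red [[1, 6]] (.nil)) (.split 5 (.red [[1, 6]] (.nil)) (.red [[3, 6]] (.br (.red
  [[4, 9]] (.br (.leaf [(1, .q 4 [1, 3, 4]), (1, .p 4), (1, .q 6 [6, 7, 9]), (1, .p 6), (1, .e
  0), (1, .e 1)]) (.br (.leaf [(1, .p 4), (1, .q 6 [5, 6, 7]), (1, .e 1)]) (.nil)))) (.br (.red
  [[1, 6]] (.br (.leaf [(1, .q 4 [3, 4, 5]), (1, .p 6), (1, .e 1)]) (.br (.leaf [(1, .q 4 [1, 3,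
  4]), (1, .p 4), (1, .q 6 [6, 7, 9]), (1, .p 6), (1, .e 0), (1, .e 1)]) (.nil)))) (.nil)))))

/-- Configuration `j8b`. -/
def cf_j8b : ℕ × List ℕ × List ℕ := (0, [1, 3, 4, 5, 6, 7, 9], [1, 4, 6, 9])

/-- Proof tree for configuration `j8`. -/
def tr_j8 : Tree :=
  .split 1 (.use 1 []) (.split 9 (.use 1 [(1, 9), (3, 7), (7, 3), (4, 6), (6, 4)]) (.split 4
  (.use 1 [(1, 4), (0, 5), (5, 0), (9, 6), (6, 9)]) (.split 6 (.use 1 [(0, 5), (1, 6), (3, 7),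
  (4, 9), (5, 0), (7, 3), (9, 4)]) (.split 0 (.use 2 []) (.split 5 (.use 2 [(1, 4), (4, 1), (0,
  5), (9, 6), (6, 9)]) (.red [[0, 4], [1, 6], [5, 9]] (.nil)))))))

/-- Configuration `j8`. -/
def cf_j8 : ℕ × List ℕ × List ℕ := (0, [0, 1, 3, 4, 5, 6, 7, 9], [])

/-- Proof tree for configuration `ii6`. -/
def tr_ii6 : Tree :=
  .split 0 (.leaf [(2, .n 5), (1, .q 5 [3, 5, 14]), (1, .e 0)]) (.split 2 (.leaf [(1, .p 0), (1,
  .q 5 [3, 5, 14]), (2, .n 14), (2, .e 0)]) (.split 5 (.leaf [(1, .n 2), (1, .q 2 [2, 3, 14]),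
  (1, .n 14), (1, .e 0)]) (.split 11 (.leaf [(1, .p 5), (2, .n 2), (1, .q 14 [2, 3, 14]), (2, .e
  0)]) (.split 14 (.leaf [(1, .p 11), (2, .n 5), (1, .q 0 [0, 3, 5]), (2, .e 0)]) (.red [[0, 2],
  [2, 5], [5, 11], [11, 14], [14, 0]] (.br (.leaf [(2, .n 9), (1, .q 11 [0, 9, 11]), (1, .p 2)])
  (.nil)))))))

/-- Configuration `ii6`. -/
def cf_ii6 : ℕ × List ℕ × List ℕ := (0, [0, 11, 2, 3, 14, 5, 9], [0, 2, 5, 11, 14])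

/-- Proof tree for configuration `iin2`. -/
def tr_iin2 : Tree :=
  .split 2 (.split 0 (.use 0 [(11, 0), (3, 1), (14, 2), (5, 2), (6, 3), (9, 4)]) (.split 5 (.use
  0 [(11, 0), (3, 1), (14, 2), (6, 3), (9, 4)]) (.split 6 (.red [[5, 11]] (.nil)) (.split 9
  (.red [[5, 11]] (.nil)) (.red [[0, 14], [5, 9], [6, 11]] (.br (.leaf [(1, .p 5), (1, .q 0 [0,
  3, 11]), (1, .e 1)]) (.br (.leaf [(1, .q 5 [3, 5, 14]), (1, .p 0), (1, .e 1)]) (.nil))))))))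
  (.split 0 (.split 5 (.use 0 [(11, 0), (2, 1), (3, 1), (14, 2), (6, 3), (9, 4)]) (.split 6
  (.red [[11, 14]] (.nil)) (.split 9 (.red [[2, 5]] (.nil)) (.red [[2, 5, 9]] (.nil))))) (.split
  5 (.split 6 (.red [[0, 2]] (.nil)) (.red [[0, 2, 6]] (.nil))) (.split 6 (.use 4 []) (.red [[0,
  2, 6]] (.nil)))))

/-- Configuration `iin2`. -/
def cf_iin2 : ℕ × List ℕ × List ℕ := (0, [0, 11, 2, 3, 14, 5, 6, 9], [11, 14])

/-- Proof tree for configuration `iia`. -/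
def tr_iia : Tree :=
  .red [[4, 11]] (.br (.split 9 (.red [[4, 11]] (.nil)) (.red [[4, 9]] (.br (.leaf [(1, .q 1 [0,
  1, 3, 11]), (1, .p 4), (1, .e 1)]) (.br (.leaf [(1, .q 1 [0, 1, 9, 11]), (1, .p 1), (1, .q 4
  [4, 6, 14]), (1, .p 4), (1, .e 0), (1, .e 1)]) (.br (.leaf [(1, .q 1 [0, 1, 9, 11]), (1, .p
  1), (1, .q 4 [4, 6, 14]), (1, .p 4), (1, .e 0), (1, .e 1)]) (.br (.leaf [(1, .q 1 [0, 1, 9,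
  11]), (1, .p 1), (1, .q 4 [4, 6, 14]), (1, .p 4), (1, .e 0), (1, .e 1)]) (.br (.leaf [(1, .q 1
  [0, 1, 3, 11]), (1, .p 4), (1, .e 1)]) (.br (.leaf [(1, .q 1 [1, 2, 3, 11]), (1, .p 4), (1, .e
  1)]) (.nil))))))))) (.br (.split 6 (.red [[4, 11]] (.nil)) (.red [[1, 6]] (.br (.leaf [(1, .q
  1 [0, 1, 9, 11]), (1, .p 1), (1, .q 4 [4, 6, 14]), (1, .p 4), (1, .e 0), (1, .e 1)]) (.br
  (.leaf [(1, .q 1 [0, 1, 9, 11]), (1, .p 1), (1, .q 4 [4, 6, 14]), (1, .p 4), (1, .e 0), (1, .e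
  1)]) (.br (.leaf [(1, .p 1), (1, .q 4 [2, 3, 4, 14]), (1, .e 1)]) (.nil)))))) (.nil)))

/-- Configuration `iia`. -/
def cf_iia : ℕ × List ℕ × List ℕ := (0, [0, 1, 2, 3, 4, 6, 9, 11, 14], [1, 4, 11])

/-- Proof tree for configuration `iib`. -/
def tr_iib : Tree :=
  .red [[4, 11]] (.br (.split 9 (.red [[4, 11]] (.nil)) (.red [[4, 9]] (.br (.leaf [(1, .q 1 [1,
  9, 11]), (1, .p 1), (1, .q 4 [4, 5, 6, 14]), (1, .p 4), (1, .e 0), (1, .e 1)]) (.br (.leaf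
  [(1, .q 1 [1, 9, 11]), (1, .p 1), (1, .q 4 [4, 5, 6, 14]), (1, .p 4), (1, .e 0), (1, .e 1)])
  (.br (.leaf [(1, .q 1 [1, 2, 3, 11]), (1, .p 4), (1, .e 1)]) (.nil)))))) (.br (.split 6 (.red
  [[4, 11]] (.nil)) (.red [[1, 6]] (.br (.leaf [(1, .q 1 [1, 9, 11]), (1, .p 1), (1, .q 4 [4, 5,
  6, 14]), (1, .p 4), (1, .e 0), (1, .e 1)]) (.br (.leaf [(1, .q 1 [1, 9, 11]), (1, .p 1), (1,
  .q 4 [4, 5, 6, 14]), (1, .p 4), (1, .e 0), (1, .e 1)]) (.br (.leaf [(1, .q 1 [1, 9, 11]), (1,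
  .p 1), (1, .q 4 [4, 5, 6, 14]), (1, .p 4), (1, .e 0), (1, .e 1)]) (.br (.leaf [(1, .p 1), (1,
  .q 4 [3, 4, 5, 14]), (1, .e 1)]) (.br (.leaf [(1, .p 1), (1, .q 4 [2, 3, 4, 14]), (1, .e 1)])
  (.br (.leaf [(1, .p 1), (1, .q 4 [3, 4, 5, 14]), (1, .e 1)]) (.nil))))))))) (.nil)))

/-- Configuration `iib`. -/
def cf_iib : ℕ × List ℕ × List ℕ := (0, [1, 2, 3, 4, 5, 6, 9, 11, 14], [1, 4, 11])

/-- Proof tree for configuration `iin3`. -/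
def tr_iin3 : Tree :=
  .split 5 (.use 6 []) (.split 0 (.use 7 []) (.split 2 (.split 6 (.red [[0, 4]] (.nil)) (.split
  9 (.red [[0, 4]] (.nil)) (.red [[0, 4], [1, 6], [5, 9]] (.br (.leaf [(1, .q 0 [0, 1, 3, 11]),
  (1, .p 5), (1, .e 1)]) (.br (.leaf [(1, .p 1), (1, .q 4 [3, 4, 5, 14]), (1, .e 1)])
  (.nil)))))) (.split 6 (.split 9 (.split 14 (.red [[1, 5]] (.nil)) (.red [[0, 14], [11, 4], [1,
  5]] (.br (.leaf [(1, .q 1 [1, 2, 3, 11]), (1, .p 4), (1, .e 2)]) (.br (.leaf [(1, .p 1), (1,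
  .q 4 [2, 3, 4, 14]), (1, .e 2)]) (.nil))))) (.red [[2, 5, 9]] (.nil))) (.red [[0, 2, 6]]
  (.nil)))))

/-- Configuration `iin3`. -/
def cf_iin3 : ℕ × List ℕ × List ℕ := (0, [0, 1, 2, 3, 4, 5, 6, 9, 11, 14], [1, 4, 11])

/-- Proof tree for configuration `n11`. -/
def tr_n11 : Tree :=
  .split 2 (.split 8 (.use 3 []) (.leaf [(2, .n 8), (1, .q 8 [6, 7, 8, 9])])) (.leaf [(2, .n 2),
  (1, .q 2 [1, 2, 3, 4])])

/-- Configuration `n11`. -/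
def cf_n11 : ℕ × List ℕ × List ℕ := (0, [0, 1, 2, 3, 4, 5, 6, 7, 8, 9], [])

/-- Proof tree for configuration `n21`. -/
def tr_n21 : Tree :=
  .split 7 (.split 8 (.use 5 []) (.leaf [(2, .n 8), (1, .q 8 [6, 8, 9])])) (.red [[7, 11, 14]]
  (.nil))

/-- Configuration `n21`. -/
def cf_n21 : ℕ × List ℕ × List ℕ := (0, [0, 2, 3, 5, 6, 7, 8, 9, 11, 14], [11, 14])

/-- Proof tree for configuration `n31`. -/
def tr_n31 : Tree :=
  .split 7 (.split 8 (.use 8 []) (.leaf [(2, .n 8), (1, .q 8 [6, 8, 9])])) (.red [[4, 7, 11]]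
  (.nil))

/-- Configuration `n31`. -/
def cf_n31 : ℕ × List ℕ × List ℕ := (0, [0, 1, 2, 3, 4, 5, 6, 7, 8, 9, 11, 14], [1, 4, 11])

/-- Proof tree for configuration `n22`. -/
def tr_n22 : Tree :=
  .split 3 (.split 7 (.split 2 (.leaf [(2, .n 11), (1, .q 11 [0, 11, 19])]) (.split 8 (.leaf
  [(1, .p 2), (1, .q 11 [0, 11, 19]), (2, .n 19)]) (.red [[8, 11, 14]] (.br (.leaf [(2, .n 0),
  (2, .p 0), (4, .n 8), (4, .n 2), (1, .q 11 [2, 11]), (2, .q 14 [5, 14, 16]), (2, .q 19 [0, 11,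
  19]), (1, .q 19 [8, 19]), (1, .e 2)]) (.br (.leaf [(2, .n 5), (2, .p 5), (4, .n 8), (4, .n 2),
  (1, .q 14 [2, 14]), (2, .q 14 [5, 14, 16]), (1, .q 16 [8, 16]), (2, .q 19 [0, 11, 19]), (1, .e
  2)]) (.nil)))))) (.red [[7, 11, 14]] (.nil))) (.red [[3, 16, 19]] (.nil))

/-- Configuration `n22`. -/
def cf_n22 : ℕ × List ℕ × List ℕ := (0, [0, 2, 3, 5, 7, 8, 11, 14, 16, 19], [11, 14, 16, 19])

/-- Proof tree for configuration `n32`. -/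
def tr_n32 : Tree :=
  .split 3 (.split 7 (.split 2 (.leaf [(1, .q 1 [0, 1, 11, 19]), (1, .p 4), (2, .n 11)]) (.split
  8 (.leaf [(1, .p 2), (1, .p 1), (1, .q 4 [4, 5, 14, 16]), (2, .n 16)]) (.red [[4, 8, 11]] (.br
  (.leaf [(1, .n 0), (2, .p 0), (4, .n 8), (3, .n 2), (2, .q 1 [0, 1, 11, 19]), (1, .p 1), (1,
  .q 4 [4, 5, 14, 16]), (2, .p 4), (1, .q 16 [8, 16]), (1, .q 19 [8, 19]), (1, .e 2)]) (.br
  (.leaf [(2, .n 5), (2, .p 5), (6, .n 8), (4, .n 2), (1, .q 1 [0, 1, 11, 19]), (5, .p 1), (3,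
  .q 4 [4, 5, 14, 16]), (1, .p 4), (2, .p 11), (2, .q 16 [8, 16]), (2, .q 19 [0, 1, 11, 19]),
  (2, .e 2)]) (.nil)))))) (.red [[4, 7, 11]] (.nil))) (.red [[3, 16, 19]] (.nil))

/-- Configuration `n32`. -/
def cf_n32 : ℕ × List ℕ × List ℕ := (0, [0, 1, 2, 3, 4, 5, 7, 8, 11, 14, 16, 19], [1, 4, 11, 16, 19])

/-- Proof tree for configuration `n33a`. -/
def tr_n33a : Tree :=
  .split 3 (.split 7 (.split 2 (.leaf [(1, .q 1 [0, 1, 9, 11, 19]), (1, .p 4), (2, .n 11)])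
  (.split 8 (.leaf [(1, .p 2), (1, .p 1), (1, .q 4 [4, 5, 6, 14, 16]), (2, .n 16)]) (.red [[4,
  8, 11]] (.br (.leaf [(2, .n 0), (2, .p 0), (4, .n 8), (6, .n 2), (2, .q 1 [1, 2, 11]), (2, .p
  1), (2, .q 4 [4, 5, 6, 14, 16]), (2, .p 4), (1, .q 6 [4, 5, 6, 14, 16]), (5, .p 6), (3, .q 9
  [0, 1, 9, 11, 19]), (1, .p 9), (2, .p 16), (2, .e 2)]) (.br (.leaf [(2, .n 5), (2, .p 5), (6,
  .n 8), (4, .n 2), (1, .q 1 [0, 1, 9, 11, 19]), (5, .p 1), (3, .q 4 [4, 5, 6, 14, 16]), (1, .p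
  4), (2, .p 11), (2, .q 6 [6, 8, 16]), (2, .p 6), (2, .q 9 [0, 1, 9, 11, 19]), (2, .p 9), (2,
  .e 2)]) (.nil)))))) (.red [[4, 7, 11]] (.nil))) (.red [[3, 9, 16]] (.nil))

/-- Configuration `n33a`. -/
def cf_n33a : ℕ × List ℕ × List ℕ := (0, [0, 1, 2, 3, 4, 5, 6, 7, 8, 9, 11, 14, 16, 19], [1, 4, 11, 6, 9, 16])

/-- Proof tree for configuration `n33b`. -/
def tr_n33b : Tree :=
  .split 3 (.split 7 (.split 2 (.leaf [(1, .q 1 [0, 1, 9, 11, 19]), (1, .p 4), (2, .n 11)])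
  (.split 8 (.leaf [(1, .p 2), (1, .q 1 [0, 1, 9, 11, 19]), (1, .p 4), (2, .n 19)]) (.red [[4,
  8, 11]] (.br (.leaf [(2, .n 0), (2, .p 0), (4, .n 8), (4, .n 2), (1, .q 1 [1, 2, 11]), (2, .p
  1), (2, .q 4 [4, 5, 6, 14, 16]), (1, .p 4), (3, .p 6), (2, .q 9 [0, 1, 9, 11, 19]), (1, .q 9
  [8, 9, 19]), (1, .e 2)]) (.br (.leaf [(1, .n 8), (1, .n 2), (2, .p 1), (1, .q 4 [4, 5, 6, 14,
  16]), (1, .p 11), (1, .p 6), (1, .q 9 [0, 1, 9, 11, 19]), (1, .p 9), (1, .p 19), (1, .e 2)])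
  (.nil)))))) (.red [[4, 7, 11]] (.nil))) (.red [[3, 6, 19]] (.nil))

/-- Configuration `n33b`. -/
def cf_n33b : ℕ × List ℕ × List ℕ := (0, [0, 1, 2, 3, 4, 5, 6, 7, 8, 9, 11, 14, 16, 19], [1, 4, 11, 6, 9, 19])

/-- Proof tree for configuration `h1`. -/
def tr_h1 : Tree :=
  .split 6 (.split 16 (.use 9 [(19, 9)]) (.split 9 (.split 19 (.use 9 [(16, 6)]) (.use 10 [(1,
  9), (2, 8), (3, 7), (4, 6), (7, 3), (8, 2), (16, 14), (19, 11)])) (.use 10 [(1, 9), (2, 8),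
  (3, 7), (4, 6), (7, 3), (8, 2), (9, 11), (16, 14), (19, 11)]))) (.split 16 (.split 9 (.split
  19 (.use 9 []) (.use 10 [(1, 9), (2, 8), (3, 7), (4, 6), (6, 14), (7, 3), (8, 2), (19, 11)]))
  (.split 19 (.use 9 []) (.use 11 [(1, 9), (2, 8), (3, 7), (4, 6), (6, 4), (7, 3), (8, 2), (9,
  1), (19, 11)]))) (.split 9 (.split 19 (.use 9 [(16, 6)]) (.use 10 [(1, 9), (2, 8), (3, 7), (4,
  6), (6, 14), (7, 3), (8, 2), (16, 14), (19, 11)])) (.use 11 [(0, 5), (1, 6), (2, 8), (3, 7),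
  (4, 9), (5, 0), (6, 1), (7, 3), (8, 2), (9, 4), (16, 11), (19, 14)])))

/-- Configuration `h1`. -/
def cf_h1 : ℕ × List ℕ × List ℕ := (0, [0, 1, 2, 3, 4, 5, 6, 7, 8, 9, 16, 19], [])

/-- Proof tree for configuration `h2`. -/
def tr_h2 : Tree :=
  .split 6 (.split 16 (.use 10 [(19, 9)]) (.split 9 (.split 19 (.use 10 [(16, 6)]) (.use 12 []))
  (.use 12 [(9, 19)]))) (.split 16 (.split 9 (.split 19 (.use 10 []) (.use 12 [(6, 16)]))
  (.split 19 (.use 10 []) (.use 13 [(2, 8), (3, 7), (6, 4), (7, 3), (8, 2), (9, 1), (11, 19),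
  (14, 16), (19, 11)]))) (.split 9 (.split 19 (.use 10 [(16, 6)]) (.use 12 [(6, 16)])) (.use 13
  [(0, 5), (2, 8), (3, 7), (5, 0), (6, 1), (7, 3), (8, 2), (9, 4), (11, 16), (14, 19), (16, 11),
  (19, 14)])))

/-- Configuration `h2`. -/
def cf_h2 : ℕ × List ℕ × List ℕ := (0, [0, 2, 3, 5, 6, 7, 8, 9, 11, 14, 16, 19], [11, 14])

/-- Proof tree for configuration `h3`. -/
def tr_h3 : Tree :=
  .split 6 (.split 16 (.use 11 [(19, 9)]) (.split 9 (.split 19 (.use 11 [(16, 6)]) (.use 13 []))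
  (.use 13 [(9, 19)]))) (.split 16 (.split 9 (.split 19 (.use 11 []) (.use 13 [(6, 16)]))
  (.split 19 (.use 11 []) (.use 15 []))) (.split 9 (.split 19 (.use 11 [(16, 6)]) (.use 13 [(6,
  16)])) (.use 14 [])))

/-- Configuration `h3`. -/
def cf_h3 : ℕ × List ℕ × List ℕ := (0, [0, 1, 2, 3, 4, 5, 6, 7, 8, 9, 11, 14, 16, 19], [1, 4, 11])

/-- Proof tree for configuration `hh`. -/
def tr_hh : Tree :=
  .split 1 (.split 11 (.use 16 [(14, 4)]) (.split 4 (.split 14 (.use 16 [(11, 1)]) (.use 17 []))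
  (.use 17 [(4, 14)]))) (.split 11 (.split 4 (.split 14 (.use 16 []) (.use 17 [(1, 11)]))
  (.split 14 (.use 16 []) (.use 18 [(0, 5), (1, 4), (4, 1), (5, 0), (6, 9), (9, 6), (14, 11),
  (16, 19), (19, 16)]))) (.split 4 (.split 14 (.use 16 [(11, 1)]) (.use 17 [(1, 11)])) (.use 18
  [])))

/-- Configuration `hh`. -/
def cf_hh : ℕ × List ℕ × List ℕ := (0, [0, 1, 2, 3, 4, 5, 6, 7, 8, 9, 11, 14, 16, 19], [])

/-- Proof tree for configuration `ap`. -/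
def tr_ap : Tree :=
  .use 19 [(1, 11), (4, 14), (6, 16), (9, 19)]

/-- Configuration `ap`. -/
def cf_ap : ℕ × List ℕ × List ℕ := (1, [0, 1, 2, 3, 4, 5, 6, 7, 8, 9], [])

/-- Proof tree for configuration `x1`. -/
def tr_x1 : Tree :=
  .split 3 (.use 20 [(10, 1), (0, 8), (5, 6), (6, 5), (8, 0)]) (.split 9 (.use 20 [(10, 2), (0,
  8), (2, 1), (3, 9), (4, 0), (5, 7), (6, 5), (7, 6), (8, 4)]) (.split 5 (.red [[3, 6, 9]] (.br
  (.leaf [(1, .q 9 [0, 7, 9]), (1, .q 3 [2, 3, 4]), (3, .n 0), (1, .q 2 [2, 3, 4]), (3, .n 6),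
  (1, .q 8 [6, 7, 8]), (1, .q 8 [7, 8, 9]), (2, .n 10), (1, .e 1)]) (.br (.leaf [(1, .q 9 [0, 7,
  9]), (2, .q 3 [2, 3, 4]), (4, .n 0), (4, .n 6), (1, .q 8 [6, 7, 8]), (2, .q 8 [7, 8, 9]), (2,
  .n 10), (1, .e 1)]) (.nil)))) (.red [[0, 4, 8], [2, 5, 9], [3, 6, 10]] (.nil))))

/-- Configuration `x1`. -/
def cf_x1 : ℕ × List ℕ × List ℕ := (1, [0, 2, 3, 4, 5, 6, 7, 8, 9, 10], [0, 2, 4, 6, 8, 10])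

/-- Proof tree for configuration `x0`. -/
def tr_x0 : Tree :=
  .split 1 (.use 20 [(10, 1), (2, 9), (3, 8), (4, 7), (5, 6), (6, 5), (7, 4), (8, 3), (9, 2)])
  (.split 3 (.use 20 [(10, 3), (1, 2), (2, 1), (4, 9), (5, 8), (6, 7), (7, 6), (8, 5), (9, 4)])
  (.split 5 (.use 20 [(10, 0), (2, 3), (3, 2), (7, 8), (8, 7)]) (.split 7 (.use 20 [(10, 3), (1,
  4), (2, 5), (3, 6), (4, 7), (5, 8), (6, 9), (8, 1), (9, 2)]) (.split 9 (.use 20 [(10, 1), (1,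
  2), (2, 3), (3, 4), (4, 5), (5, 6), (6, 7), (7, 8), (8, 9)]) (.red [[1, 4, 7], [2, 6, 9]]
  (.nil))))))

/-- Configuration `x0`. -/
def cf_x0 : ℕ × List ℕ × List ℕ := (1, [1, 2, 3, 4, 5, 6, 7, 8, 9, 10], [2, 4, 6, 8, 10])

/-- Proof tree for configuration `b`. -/
def tr_b : Tree :=
  .split 2 (.use 20 [(10, 2), (0, 5), (1, 4), (3, 6), (4, 8), (5, 7), (6, 9), (7, 0), (8, 1),
  (9, 3)]) (.split 4 (.use 20 [(10, 1), (0, 5), (1, 3), (3, 4), (5, 6), (6, 8), (8, 9), (9, 0)])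
  (.split 6 (.use 20 [(10, 1), (0, 5), (1, 0), (2, 9), (3, 7), (4, 8), (5, 6), (7, 4), (8, 2),
  (9, 3)]) (.split 8 (.use 20 [(10, 2), (0, 5), (1, 3), (2, 1), (3, 0), (4, 9), (5, 7), (6, 8),
  (7, 6), (9, 4)]) (.split 10 (.use 20 []) (.split 0 (.use 22 []) (.split 1 (.use 21 [(10, 2),
  (2, 10), (3, 9), (4, 8), (5, 7), (7, 5), (8, 4), (9, 3)]) (.split 3 (.use 21 [(10, 4), (1, 3),
  (4, 10), (5, 9), (6, 8), (8, 6), (9, 5)]) (.split 5 (.use 21 [(10, 6), (1, 5), (2, 4), (4, 2),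
  (6, 10), (7, 9), (9, 7)]) (.split 7 (.use 21 [(10, 4), (1, 5), (2, 6), (3, 7), (4, 8), (5, 9),
  (6, 10), (8, 2), (9, 3)]) (.split 9 (.use 21 [(10, 2), (1, 3), (2, 4), (3, 5), (4, 6), (5, 7),
  (6, 8), (7, 9), (8, 10)]) (.red [[0, 2, 6], [1, 4, 8], [3, 7, 10], [5, 9]] (.nil))))))))))))

/-- Configuration `b`. -/
def cf_b : ℕ × List ℕ × List ℕ := (1, [0, 1, 2, 3, 4, 5, 6, 7, 8, 9, 10], [])

/-- Proof tree for configuration `ico`. -/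
def tr_ico : Tree :=
  .split 0 (.use 23 [(10, 1), (11, 0), (1, 2), (2, 3), (3, 4), (4, 5), (5, 6), (6, 7), (7, 8),
  (8, 9), (9, 10)]) (.split 1 (.use 23 [(10, 2), (11, 1), (0, 6), (2, 10), (3, 8), (4, 9), (5,
  7), (6, 0), (7, 5), (8, 3), (9, 4)]) (.split 2 (.use 23 [(10, 2), (11, 4), (0, 9), (1, 10),
  (3, 8), (4, 6), (5, 7), (6, 5), (7, 0), (8, 3), (9, 1)]) (.split 3 (.use 23 [(10, 1), (11, 3),
  (0, 8), (1, 10), (5, 6), (6, 5), (8, 0)]) (.split 4 (.use 23 [(10, 1), (11, 2), (0, 7), (1,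
  9), (2, 10), (3, 8), (5, 6), (6, 4), (7, 5), (8, 3), (9, 0)]) (.split 5 (.use 23 [(10, 0),
  (11, 1), (0, 6), (1, 5), (2, 3), (3, 4), (4, 2), (6, 10), (7, 8), (8, 9), (9, 7)]) (.split 6
  (.use 23 [(10, 1), (11, 2), (0, 7), (1, 0), (2, 3), (3, 5), (5, 6), (7, 8), (8, 10)]) (.split
  7 (.use 23 [(10, 1), (11, 3), (0, 8), (1, 9), (2, 0), (3, 7), (4, 5), (5, 6), (6, 4), (8, 2),
  (9, 10)]) (.split 8 (.use 23 [(10, 2), (11, 4), (0, 9), (2, 3), (3, 0), (4, 5), (5, 7), (7,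
  8), (9, 10)]) (.split 9 (.use 23 [(10, 2), (11, 1), (0, 6), (1, 4), (2, 3), (3, 5), (4, 0),
  (5, 7), (6, 9), (7, 8), (8, 10)]) (.split 10 (.use 23 [(11, 2), (0, 7), (1, 6), (2, 4), (3,
  5), (4, 3), (5, 0), (6, 1), (7, 9), (8, 10), (9, 8)]) (.split 11 (.use 23 [(10, 2), (2, 10),
  (3, 9), (4, 8), (5, 7), (7, 5), (8, 4), (9, 3)]) (.red [[0, 2, 6], [1, 4, 8], [3, 7, 10], [5,
  9, 11]] (.nil)))))))))))))

/-- Configuration `ico`. -/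
def cf_ico : ℕ × List ℕ × List ℕ := (1, [0, 1, 2, 3, 4, 5, 6, 7, 8, 9, 10, 11], [])

section
variable {V : Type*} {G : SimpleGraph V}

lemma env_0 : ∀ e ∈ ([] : List (ℕ × List ℕ × List ℕ)), Refuted G e := by simp

lemma env_snoc {env : List (ℕ × List ℕ × List ℕ)} {e : ℕ × List ℕ × List ℕ} (t : Tree)
    (henv : ∀ e ∈ env, Refuted G e) (hc : chk env e.1 t e.2.1 e.2.2 [] none = true) :
    ∀ e' ∈ env ++ [e], Refuted G e' := by
  intro e' he'
  rw [List.mem_append, List.mem_singleton] at he'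
  rcases he' with h | rfl
  · exact henv e' h
  · exact refute env henv _ t hc

/-- Refuted configurations up to `c5`. -/
def ev_c5 : List (ℕ × List ℕ × List ℕ) := [] ++ [cf_c5]

lemma rf_c5 : ∀ e ∈ ev_c5, Refuted G e :=
  env_snoc (env := []) (e := cf_c5) tr_c5 env_0 (by decide +kernel)

/-- Refuted configurations up to `j8a`. -/
def ev_j8a : List (ℕ × List ℕ × List ℕ) := ev_c5 ++ [cf_j8a]

lemma rf_j8a : ∀ e ∈ ev_j8a, Refuted G e :=
  env_snoc (env := ev_c5) (e := cf_j8a) tr_j8a rf_c5 (by decide +kernel)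

/-- Refuted configurations up to `j8b`. -/
def ev_j8b : List (ℕ × List ℕ × List ℕ) := ev_j8a ++ [cf_j8b]

lemma rf_j8b : ∀ e ∈ ev_j8b, Refuted G e :=
  env_snoc (env := ev_j8a) (e := cf_j8b) tr_j8b rf_j8a (by decide +kernel)

/-- Refuted configurations up to `j8`. -/
def ev_j8 : List (ℕ × List ℕ × List ℕ) := ev_j8b ++ [cf_j8]

lemma rf_j8 : ∀ e ∈ ev_j8, Refuted G e :=
  env_snoc (env := ev_j8b) (e := cf_j8) tr_j8 rf_j8b (by decide +kernel)

/-- Refuted configurations up to `ii6`. -/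
def ev_ii6 : List (ℕ × List ℕ × List ℕ) := ev_j8 ++ [cf_ii6]

lemma rf_ii6 : ∀ e ∈ ev_ii6, Refuted G e :=
  env_snoc (env := ev_j8) (e := cf_ii6) tr_ii6 rf_j8 (by decide +kernel)

/-- Refuted configurations up to `iin2`. -/
def ev_iin2 : List (ℕ × List ℕ × List ℕ) := ev_ii6 ++ [cf_iin2]

lemma rf_iin2 : ∀ e ∈ ev_iin2, Refuted G e :=
  env_snoc (env := ev_ii6) (e := cf_iin2) tr_iin2 rf_ii6 (by decide +kernel)

/-- Refuted configurations up to `iia`. -/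
def ev_iia : List (ℕ × List ℕ × List ℕ) := ev_iin2 ++ [cf_iia]

lemma rf_iia : ∀ e ∈ ev_iia, Refuted G e :=
  env_snoc (env := ev_iin2) (e := cf_iia) tr_iia rf_iin2 (by decide +kernel)

/-- Refuted configurations up to `iib`. -/
def ev_iib : List (ℕ × List ℕ × List ℕ) := ev_iia ++ [cf_iib]

lemma rf_iib : ∀ e ∈ ev_iib, Refuted G e :=
  env_snoc (env := ev_iia) (e := cf_iib) tr_iib rf_iia (by decide +kernel)

/-- Refuted configurations up to `iin3`. -/
def ev_iin3 : List (ℕ × List ℕ × List ℕ) := ev_iib ++ [cf_iin3]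

lemma rf_iin3 : ∀ e ∈ ev_iin3, Refuted G e :=
  env_snoc (env := ev_iib) (e := cf_iin3) tr_iin3 rf_iib (by decide +kernel)

/-- Refuted configurations up to `n11`. -/
def ev_n11 : List (ℕ × List ℕ × List ℕ) := ev_iin3 ++ [cf_n11]

lemma rf_n11 : ∀ e ∈ ev_n11, Refuted G e :=
  env_snoc (env := ev_iin3) (e := cf_n11) tr_n11 rf_iin3 (by decide +kernel)

/-- Refuted configurations up to `n21`. -/
def ev_n21 : List (ℕ × List ℕ × List ℕ) := ev_n11 ++ [cf_n21]

lemma rf_n21 : ∀ e ∈ ev_n21, Refuted G e :=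
  env_snoc (env := ev_n11) (e := cf_n21) tr_n21 rf_n11 (by decide +kernel)

/-- Refuted configurations up to `n31`. -/
def ev_n31 : List (ℕ × List ℕ × List ℕ) := ev_n21 ++ [cf_n31]

lemma rf_n31 : ∀ e ∈ ev_n31, Refuted G e :=
  env_snoc (env := ev_n21) (e := cf_n31) tr_n31 rf_n21 (by decide +kernel)

/-- Refuted configurations up to `n22`. -/
def ev_n22 : List (ℕ × List ℕ × List ℕ) := ev_n31 ++ [cf_n22]

lemma rf_n22 : ∀ e ∈ ev_n22, Refuted G e :=
  env_snoc (env := ev_n31) (e := cf_n22) tr_n22 rf_n31 (by decide +kernel)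

/-- Refuted configurations up to `n32`. -/
def ev_n32 : List (ℕ × List ℕ × List ℕ) := ev_n22 ++ [cf_n32]

lemma rf_n32 : ∀ e ∈ ev_n32, Refuted G e :=
  env_snoc (env := ev_n22) (e := cf_n32) tr_n32 rf_n22 (by decide +kernel)

/-- Refuted configurations up to `n33a`. -/
def ev_n33a : List (ℕ × List ℕ × List ℕ) := ev_n32 ++ [cf_n33a]

lemma rf_n33a : ∀ e ∈ ev_n33a, Refuted G e :=
  env_snoc (env := ev_n32) (e := cf_n33a) tr_n33a rf_n32 (by decide +kernel)

/-- Refuted configurations up to `n33b`. -/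
def ev_n33b : List (ℕ × List ℕ × List ℕ) := ev_n33a ++ [cf_n33b]

lemma rf_n33b : ∀ e ∈ ev_n33b, Refuted G e :=
  env_snoc (env := ev_n33a) (e := cf_n33b) tr_n33b rf_n33a (by decide +kernel)

/-- Refuted configurations up to `h1`. -/
def ev_h1 : List (ℕ × List ℕ × List ℕ) := ev_n33b ++ [cf_h1]

lemma rf_h1 : ∀ e ∈ ev_h1, Refuted G e :=
  env_snoc (env := ev_n33b) (e := cf_h1) tr_h1 rf_n33b (by decide +kernel)

/-- Refuted configurations up to `h2`. -/
def ev_h2 : List (ℕ × List ℕ × List ℕ) := ev_h1 ++ [cf_h2]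

lemma rf_h2 : ∀ e ∈ ev_h2, Refuted G e :=
  env_snoc (env := ev_h1) (e := cf_h2) tr_h2 rf_h1 (by decide +kernel)

/-- Refuted configurations up to `h3`. -/
def ev_h3 : List (ℕ × List ℕ × List ℕ) := ev_h2 ++ [cf_h3]

lemma rf_h3 : ∀ e ∈ ev_h3, Refuted G e :=
  env_snoc (env := ev_h2) (e := cf_h3) tr_h3 rf_h2 (by decide +kernel)

/-- Refuted configurations up to `hh`. -/
def ev_hh : List (ℕ × List ℕ × List ℕ) := ev_h3 ++ [cf_hh]

lemma rf_hh : ∀ e ∈ ev_hh, Refuted G e :=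
  env_snoc (env := ev_h3) (e := cf_hh) tr_hh rf_h3 (by decide +kernel)

/-- Refuted configurations up to `ap`. -/
def ev_ap : List (ℕ × List ℕ × List ℕ) := ev_hh ++ [cf_ap]

lemma rf_ap : ∀ e ∈ ev_ap, Refuted G e :=
  env_snoc (env := ev_hh) (e := cf_ap) tr_ap rf_hh (by decide +kernel)

/-- Refuted configurations up to `x1`. -/
def ev_x1 : List (ℕ × List ℕ × List ℕ) := ev_ap ++ [cf_x1]

lemma rf_x1 : ∀ e ∈ ev_x1, Refuted G e :=
  env_snoc (env := ev_ap) (e := cf_x1) tr_x1 rf_ap (by decide +kernel)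

/-- Refuted configurations up to `x0`. -/
def ev_x0 : List (ℕ × List ℕ × List ℕ) := ev_x1 ++ [cf_x0]

lemma rf_x0 : ∀ e ∈ ev_x0, Refuted G e :=
  env_snoc (env := ev_x1) (e := cf_x0) tr_x0 rf_x1 (by decide +kernel)

/-- Refuted configurations up to `b`. -/
def ev_b : List (ℕ × List ℕ × List ℕ) := ev_x0 ++ [cf_b]

lemma rf_b : ∀ e ∈ ev_b, Refuted G e :=
  env_snoc (env := ev_x0) (e := cf_b) tr_b rf_x0 (by decide +kernel)

/-- Refuted configurations up to `ico`. -/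
def ev_ico : List (ℕ × List ℕ × List ℕ) := ev_b ++ [cf_ico]

lemma rf_ico : ∀ e ∈ ev_ico, Refuted G e :=
  env_snoc (env := ev_b) (e := cf_ico) tr_ico rf_b (by decide +kernel)

end
end Ico

namespace Ico
section
variable {V : Type*}

lemma QQ.le {G G' : SimpleGraph V} {S : Finset V} {k : ℕ} (q : QQ G S k) (h : G' ≤ G) :
    QQ G' S k := by
  classical
  intro v hv K hK hc hvK
  have h1 := q v hv K hK (fun a ha b hb hab => h (hc ha hb hab)) hvK
  have h2 : cn G' S v ⊆ cn G S v := by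
    intro u hu
    simp only [cn, Finset.mem_filter] at *
    exact ⟨hu.1, hu.2.imp id (fun e => h e)⟩
  have := Finset.card_le_card h2
  omega

lemma inj_maps (X : Finset V) (Y : Finset ℕ) (h : X.card ≤ Y.card) :
    ∃ e : V → ℕ, Set.InjOn e X ∧ ∀ v ∈ X, e v ∈ Y := by
  classical
  obtain ⟨Z, hZ, hc⟩ := Finset.exists_subset_card_eq h
  let e := Finset.equivOfCardEq hc.symm
  refine ⟨fun v => if hv : v ∈ X then (e ⟨v, hv⟩ : ℕ) else 0, ?_, ?_⟩
  · intro a ha b hb hab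
    have ha' : a ∈ X := ha
    have hb' : b ∈ X := hb
    simp only [ha', hb', dif_pos] at hab
    have := e.injective (Subtype.ext hab)
    simpa using this
  · intro v hv
    simp only [hv, dif_pos]
    exact hZ (e ⟨v, hv⟩).2

/-- A large matching in the bipartite complement between two cliques. -/
lemma antimatch (G : SimpleGraph V) (A B : Finset V) (hA : G.IsClique (A : Set V))
    (hB : G.IsClique (B : Set V)) (n : ℕ)
    (hmax : ∀ K : Finset V, (∀ v ∈ K, v ∈ A ∨ v ∈ B) → G.IsClique (K : Set V) → K.card ≤ n)
    (hAB : Disjoint A B) (q : ℕ) (hq : q + n ≤ A.card + B.card) :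
    ∃ A1 ⊆ A, A1.card = q ∧ ∃ m : V → V, Set.InjOn m A1 ∧ ∀ a ∈ A1, m a ∈ B ∧ ¬ G.Adj a (m a) := by
  classical
  have hBn : B.card ≤ n := hmax B (fun v hv => Or.inr hv) hB
  obtain ⟨d, hd⟩ := Nat.exists_eq_add_of_le hBn
  let t : {a // a ∈ A} → Finset (V ⊕ Fin d) := fun a =>
    (B.filter (fun b => ¬ G.Adj a b)).disjSum Finset.univ
  have hall : ∀ s : Finset {a // a ∈ A}, s.card ≤ (s.biUnion t).card := by
    intro s
    rcases s.eq_empty_or_nonempty with rfl | ⟨a0, ha0⟩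
    · simp
    let Nn := B.filter (fun b => ∃ a ∈ s, ¬ G.Adj a b)
    have hsub : Nn.disjSum (Finset.univ : Finset (Fin d)) ⊆ s.biUnion t := by
      intro z hz
      rw [Finset.mem_biUnion]
      rcases z with b | i
      · rw [Finset.inl_mem_disjSum, Finset.mem_filter] at hz
        obtain ⟨hb, a, ha, hab⟩ := hz
        refine ⟨a, ha, ?_⟩
        rw [Finset.inl_mem_disjSum, Finset.mem_filter]
        exact ⟨hb, hab⟩
      · exact ⟨a0, ha0, by simp [t]⟩
    have h1 := Finset.card_le_card hsub
    rw [Finset.card_disjSum, Finset.card_univ, Fintype.card_fin] at h1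
    let X := s.map (Function.Embedding.subtype _)
    have hX : X.card = s.card := Finset.card_map _
    have hXA : ∀ v ∈ X, v ∈ A := by
      intro v hv
      simp only [X, Finset.mem_map, Function.Embedding.coe_subtype] at hv
      obtain ⟨a, _, rfl⟩ := hv
      exact a.2
    have hdis : Disjoint X (B \ Nn) := by
      rw [Finset.disjoint_left]
      intro v hv hv'
      exact Finset.disjoint_left.1 hAB (hXA v hv) (Finset.mem_sdiff.1 hv').1
    have hXB : ∀ v ∈ X, ∀ b ∈ B \ Nn, G.Adj v b := by
      intro v hv b hb
      rw [Finset.mem_sdiff, Finset.mem_filter] at hb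
      by_contra hn
      simp only [X, Finset.mem_map, Function.Embedding.coe_subtype] at hv
      obtain ⟨a, ha, rfl⟩ := hv
      exact hb.2 ⟨hb.1, a, ha, hn⟩
    have h2 := hmax (X ∪ (B \ Nn)) (by
      intro v hv
      rw [Finset.mem_union] at hv
      rcases hv with hv | hv
      · exact Or.inl (hXA v hv)
      · exact Or.inr (Finset.mem_sdiff.1 hv).1) (by
      intro u hu v hv huv
      rw [Finset.mem_coe, Finset.mem_union] at hu hv
      rcases hu with hu | hu <;> rcases hv with hv | hv
      · exact hA (hXA u hu) (hXA v hv) huv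
      · exact hXB u hu v hv
      · exact (hXB v hv u hu).symm
      · exact hB (Finset.mem_sdiff.1 hu).1 (Finset.mem_sdiff.1 hv).1 huv)
    have hs : (B \ Nn).card = B.card - Nn.card :=
      Finset.card_sdiff_of_subset (Finset.filter_subset _ _)
    rw [Finset.card_union_of_disjoint hdis, hX, hs] at h2
    have h3 : Nn.card ≤ B.card := Finset.card_le_card (Finset.filter_subset _ _)
    omega
  obtain ⟨g, hg1, hg2⟩ := (Finset.all_card_le_biUnion_card_iff_exists_injective t).1 hall
  let A0 : Finset {a // a ∈ A} := Finset.univ.filter (fun a => ∃ b, g a = Sum.inl b)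
  let A2 : Finset {a // a ∈ A} := Finset.univ.filter (fun a => ¬ ∃ b, g a = Sum.inl b)
  have hA2 : A2.card ≤ d := by
    have h1 : A2.image g ⊆ (Finset.univ : Finset (Fin d)).image Sum.inr := by
      intro z hz
      rw [Finset.mem_image] at hz
      obtain ⟨a, ha, rfl⟩ := hz
      rw [Finset.mem_filter] at ha
      rcases hga : g a with b | i
      · exact absurd ⟨b, hga⟩ ha.2
      · simp
    have h2 := Finset.card_le_card h1
    rw [Finset.card_image_of_injective _ hg1] at h2
    have h3 := Finset.card_image_le (s := (Finset.univ : Finset (Fin d)))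
      (f := (Sum.inr : Fin d → V ⊕ Fin d))
    simp only [Finset.card_univ, Fintype.card_fin] at h3
    omega
  have hA02 : A0.card + A2.card = A.card := by
    have := Finset.card_filter_add_card_filter_not (s := (Finset.univ : Finset {a // a ∈ A}))
      (fun a => ∃ b, g a = Sum.inl b)
    rw [Finset.card_univ, Fintype.card_coe] at this
    exact this
  obtain ⟨A1, hA1, hA1c⟩ := Finset.exists_subset_card_eq (show q ≤ A0.card by omega)
  have hm : ∀ a : V, ∃ b : V, ∀ h : a ∈ A, ⟨a, h⟩ ∈ A1 → g ⟨a, h⟩ = Sum.inl b := by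
    intro a
    by_cases h : ∃ h : a ∈ A, (⟨a, h⟩ : {a // a ∈ A}) ∈ A1
    · obtain ⟨h1, h2⟩ := h
      obtain ⟨b, hb⟩ := (Finset.mem_filter.1 (hA1 h2)).2
      exact ⟨b, fun _ _ => hb⟩
    · exact ⟨a, fun h1 h2 => absurd ⟨h1, h2⟩ h⟩
  choose m hm using hm
  refine ⟨A1.map (Function.Embedding.subtype _), ?_, ?_, m, ?_, ?_⟩
  · intro v hv
    simp only [Finset.mem_map, Function.Embedding.coe_subtype] at hv
    obtain ⟨a, _, rfl⟩ := hv
    exact a.2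
  · rw [Finset.card_map, hA1c]
  · intro u hu v hv huv
    simp only [Finset.coe_map, Function.Embedding.coe_subtype, Set.mem_image, Finset.mem_coe]
      at hu hv
    obtain ⟨a, ha, rfl⟩ := hu
    obtain ⟨b, hb, rfl⟩ := hv
    have h1 := hm a a.2 ha
    have h2 := hm b b.2 hb
    rw [huv, ← h2] at h1
    exact congrArg Subtype.val (hg1 h1)
  · intro v hv
    simp only [Finset.mem_map, Function.Embedding.coe_subtype] at hv
    obtain ⟨a, ha, rfl⟩ := hv
    have h1 := hm a a.2 ha
    have h2 := hg2 a
    have h3 : g a = Sum.inl (m a) := h1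
    rw [h3, Finset.inl_mem_disjSum, Finset.mem_filter] at h2
    exact h2

/-- Reduction of a homogeneous pair of cliques to a skeletal one. -/
lemma skel (G : SimpleGraph V) (S A B : Finset V) (hAS : A ⊆ S) (hBS : B ⊆ S)
    (hAB : Disjoint A B) (hA : G.IsClique (A : Set V)) (hB : G.IsClique (B : Set V))
    (homA : ∀ v ∈ S, v ∉ A → v ∉ B → (∃ a ∈ A, G.Adj a v) → ∀ a ∈ A, G.Adj a v)
    (homB : ∀ v ∈ S, v ∉ A → v ∉ B → (∃ a ∈ B, G.Adj a v) → ∀ a ∈ B, G.Adj a v) :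
    ∃ G' : SimpleGraph V, ∃ K : Set V, G' ≤ G ∧
      (∀ u v, ¬ (u ∈ A ∧ v ∈ B ∨ u ∈ B ∧ v ∈ A) → (G'.Adj u v ↔ G.Adj u v)) ∧
      (∀ a ∈ A, ∀ b ∈ B, G'.Adj a b ↔ a ∈ K ∧ b ∈ K) ∧
      ∀ k, Col G' S k → Col G S k := by
  classical
  obtain ⟨K, hK, hKmax⟩ := Finset.exists_max_image
    ((A ∪ B).powerset.filter (fun K : Finset V => G.IsClique (K : Set V))) Finset.card
    ⟨∅, by simp⟩
  rw [Finset.mem_filter, Finset.mem_powerset] at hK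
  obtain ⟨hKAB, hKc⟩ := hK
  have hmax : ∀ L : Finset V, (∀ v ∈ L, v ∈ A ∨ v ∈ B) → G.IsClique (L : Set V) →
      L.card ≤ K.card := by
    intro L hL hLc
    apply hKmax
    rw [Finset.mem_filter, Finset.mem_powerset]
    exact ⟨fun v hv => Finset.mem_union.2 (hL v hv), hLc⟩
  let G' : SimpleGraph V :=
    { Adj := fun u v => G.Adj u v ∧ ((u ∈ A ∧ v ∈ B ∨ u ∈ B ∧ v ∈ A) → u ∈ K ∧ v ∈ K)
      symm := ⟨fun u v h => ⟨h.1.symm, fun h' => (h.2 (by tauto)).symm⟩⟩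
      loopless := ⟨fun u h => h.1.ne rfl⟩ }
  have hAd : ∀ u v, G'.Adj u v ↔ (G.Adj u v ∧ ((u ∈ A ∧ v ∈ B ∨ u ∈ B ∧ v ∈ A) → u ∈ K ∧ v ∈ K)) :=
    fun _ _ => Iff.rfl
  have hnotB : ∀ v, v ∈ A → v ∉ B := fun v h h' => Finset.disjoint_left.1 hAB h h'
  have hnon : ∀ u v, ¬ (u ∈ A ∧ v ∈ B ∨ u ∈ B ∧ v ∈ A) → (G'.Adj u v ↔ G.Adj u v) := by
    intro u v h
    rw [hAd]
    exact ⟨fun e => e.1, fun e => ⟨e, fun e' => absurd e' h⟩⟩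
  refine ⟨G', K, fun u v h => h.1, hnon, ?_, ?_⟩
  · intro a ha b hb
    rw [hAd]
    constructor
    · intro h
      exact h.2 (Or.inl ⟨ha, hb⟩)
    · intro h
      refine ⟨hKc h.1 h.2 ?_, fun _ => h⟩
      rintro rfl
      exact hnotB a ha hb
  rintro k ⟨c, hck, hc⟩
  have cA : Set.InjOn c A := by
    intro u hu v hv huv
    by_contra hne
    refine hc u (hAS hu) v (hAS hv) ((hnon u v ?_).2 (hA hu hv hne)) huv
    have := hnotB u hu
    have := hnotB v hv
    tauto
  have cB : Set.InjOn c B := by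
    intro u hu v hv huv
    by_contra hne
    refine hc u (hBS hu) v (hBS hv) ((hnon u v ?_).2 (hB hu hv hne)) huv
    rintro (h | h)
    · exact hnotB u h.1 hu
    · exact hnotB v h.2 hv
  have hKS : K ⊆ S := hKAB.trans (Finset.union_subset hAS hBS)
  have cK : Set.InjOn c K := by
    intro u hu v hv huv
    by_contra hne
    exact hc u (hKS hu) v (hKS hv) ((hAd u v).2 ⟨hKc hu hv hne, fun _ => ⟨hu, hv⟩⟩) huv
  let P := A.image c ∩ B.image c
  have hAc : (A.image c).card = A.card := Finset.card_image_of_injOn cA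
  have hBc : (B.image c).card = B.card := Finset.card_image_of_injOn cB
  have hPc : P.card + K.card ≤ A.card + B.card := by
    have h1 : K.image c ⊆ A.image c ∪ B.image c := by
      rw [← Finset.image_union]
      exact Finset.image_subset_image hKAB
    have h2 := Finset.card_le_card h1
    rw [Finset.card_image_of_injOn cK] at h2
    have h3 := Finset.card_union_add_card_inter (A.image c) (B.image c)
    rw [hAc, hBc] at h3
    change _ + P.card = _ at h3
    omega
  obtain ⟨A1, hA1, hA1c, m, hmi, hm⟩ := antimatch G A B hA hB K.card hmax hAB P.card hPc
  have hB1s : A1.image m ⊆ B := by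
    intro b hb
    rw [Finset.mem_image] at hb
    obtain ⟨a, ha, rfl⟩ := hb
    exact (hm a ha).1
  have hB1c : (A1.image m).card = P.card := by rw [Finset.card_image_of_injOn hmi, hA1c]
  obtain ⟨e1, he1, he1P⟩ := inj_maps A1 P hA1c.le
  obtain ⟨e2, he2, he2P⟩ := inj_maps (A \ A1) (A.image c \ P) (by
    rw [Finset.card_sdiff_of_subset hA1, Finset.card_sdiff_of_subset Finset.inter_subset_left,
      hAc, hA1c])
  obtain ⟨e3, he3, he3P⟩ := inj_maps (B \ A1.image m) (B.image c \ P) (by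
    rw [Finset.card_sdiff_of_subset hB1s, Finset.card_sdiff_of_subset Finset.inter_subset_right,
      hBc, hB1c])
  have hn : ∀ b, b ∈ A1.image m → ∃ a, a ∈ A1 ∧ m a = b := fun b hb => by
    simpa using hb
  have hn' : ∀ b : V, ∃ a : V, b ∈ A1.image m → a ∈ A1 ∧ m a = b := by
    intro b
    by_cases h : b ∈ A1.image m
    · obtain ⟨a, ha⟩ := hn b h
      exact ⟨a, fun _ => ha⟩
    · exact ⟨b, fun h' => absurd h' h⟩
  choose n hnm using hn'
  let c' : V → ℕ := fun v => if v ∈ A then (if v ∈ A1 then e1 v else e2 v) else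
    if v ∈ B then (if v ∈ A1.image m then e1 (n v) else e3 v) else c v
  have cA' : ∀ v ∈ A, c' v = if v ∈ A1 then e1 v else e2 v := fun v hv => by simp only [c', hv, if_true]
  have cB' : ∀ v ∈ B, c' v = if v ∈ A1.image m then e1 (n v) else e3 v := fun v hv => by
    have : v ∉ A := fun h => hnotB v h hv
    simp only [c', hv, this, if_true, if_false]
  have cO' : ∀ v, v ∉ A → v ∉ B → c' v = c v := fun v h1 h2 => by
    simp only [c', h1, h2, if_false]
  have memA : ∀ v ∈ A, c' v ∈ A.image c ∧ (c' v ∈ P → v ∈ A1 ∧ c' v = e1 v) := by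
    intro v hv
    rw [cA' v hv]
    split_ifs with h
    · exact ⟨(Finset.mem_inter.1 (he1P v h)).1, fun _ => ⟨h, rfl⟩⟩
    · have := Finset.mem_sdiff.1 (he2P v (Finset.mem_sdiff.2 ⟨hv, h⟩))
      exact ⟨this.1, fun h' => absurd h' this.2⟩
  have memB : ∀ v ∈ B, c' v ∈ B.image c ∧
      (c' v ∈ P → v ∈ A1.image m ∧ c' v = e1 (n v)) := by
    intro v hv
    rw [cB' v hv]
    split_ifs with h
    · exact ⟨(Finset.mem_inter.1 (he1P _ (hnm v h).1)).2, fun _ => ⟨h, rfl⟩⟩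
    · have := Finset.mem_sdiff.1 (he3P v (Finset.mem_sdiff.2 ⟨hv, h⟩))
      exact ⟨this.1, fun h' => absurd h' this.2⟩
  have injA : ∀ u ∈ A, ∀ v ∈ A, c' u = c' v → u = v := by
    intro u hu v hv huv
    by_cases h : c' u ∈ P
    · have h1 := (memA u hu).2 h
      have h2 := (memA v hv).2 (huv ▸ h)
      exact he1 h1.1 h2.1 (by rw [← h1.2, ← h2.2, huv])
    · have h1 : u ∉ A1 := fun h' => h (by rw [cA' u hu, if_pos h']; exact he1P u h')
      have h2 : v ∉ A1 := fun h' => h (by rw [huv, cA' v hv, if_pos h']; exact he1P v h')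
      rw [cA' u hu, cA' v hv, if_neg h1, if_neg h2] at huv
      exact he2 (by simp [hu, h1]) (by simp [hv, h2]) huv
  have injB : ∀ u ∈ B, ∀ v ∈ B, c' u = c' v → u = v := by
    intro u hu v hv huv
    by_cases h : c' u ∈ P
    · have h1 := (memB u hu).2 h
      have h2 := (memB v hv).2 (huv ▸ h)
      have h3 : n u = n v := he1 (hnm u h1.1).1 (hnm v h2.1).1 (by rw [← h1.2, ← h2.2, huv])
      rw [← (hnm u h1.1).2, ← (hnm v h2.1).2, h3]
    · have h1 : u ∉ A1.image m := fun h' => h (by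
        rw [cB' u hu, if_pos h']; exact he1P _ (hnm u h').1)
      have h2 : v ∉ A1.image m := fun h' => h (by
        rw [huv, cB' v hv, if_pos h']; exact he1P _ (hnm v h').1)
      rw [cB' u hu, cB' v hv, if_neg h1, if_neg h2] at huv
      exact he3 (by rw [Finset.coe_sdiff]; exact ⟨hu, h1⟩)
        (by rw [Finset.coe_sdiff]; exact ⟨hv, h2⟩) huv
  have crossAB : ∀ u ∈ A, ∀ v ∈ B, G.Adj u v → c' u ≠ c' v := by
    intro u hu v hv huv e
    have h : c' u ∈ P := Finset.mem_inter.2 ⟨(memA u hu).1, e ▸ (memB v hv).1⟩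
    have h1 := (memA u hu).2 h
    have h2 := (memB v hv).2 (e ▸ h)
    have h3 : u = n v := he1 h1.1 (hnm v h2.1).1 (by rw [← h1.2, ← h2.2, e])
    have h4 := (hm u h1.1).2
    rw [h3, (hnm v h2.1).2, ← h3] at h4
    exact h4 huv
  have outA : ∀ u ∈ A, ∀ v ∈ S, v ∉ A → v ∉ B → G.Adj u v → c' u ≠ c' v := by
    intro u hu v hv hvA hvB huv e
    have h1 := (memA u hu).1
    rw [e, cO' v hvA hvB, Finset.mem_image] at h1
    obtain ⟨a, ha, hac⟩ := h1
    refine hc a (hAS ha) v hv ((hnon a v (by tauto)).2 (homA v hv hvA hvB ⟨u, hu, huv⟩ a ha)) hac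
  have outB : ∀ u ∈ B, ∀ v ∈ S, v ∉ A → v ∉ B → G.Adj u v → c' u ≠ c' v := by
    intro u hu v hv hvA hvB huv e
    have h1 := (memB u hu).1
    rw [e, cO' v hvA hvB, Finset.mem_image] at h1
    obtain ⟨a, ha, hac⟩ := h1
    refine hc a (hBS ha) v hv ((hnon a v (by tauto)).2 (homB v hv hvA hvB ⟨u, hu, huv⟩ a ha)) hac
  refine ⟨c', ?_, ?_⟩
  · intro v hv
    by_cases hvA : v ∈ A
    · obtain ⟨a, ha, hac⟩ := Finset.mem_image.1 (memA v hvA).1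
      rw [← hac]; exact hck a (hAS ha)
    · by_cases hvB : v ∈ B
      · obtain ⟨a, ha, hac⟩ := Finset.mem_image.1 (memB v hvB).1
        rw [← hac]; exact hck a (hBS ha)
      · rw [cO' v hvA hvB]; exact hck v hv
  · intro u hu v hv huv
    by_cases huA : u ∈ A
    · by_cases hvA : v ∈ A
      · exact fun e => huv.ne (injA u huA v hvA e)
      · by_cases hvB : v ∈ B
        · exact crossAB u huA v hvB huv
        · exact outA u huA v hv hvA hvB huv
    · by_cases huB : u ∈ B
      · by_cases hvA : v ∈ A
        · exact (crossAB v hvA u huB huv.symm).symm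
        · by_cases hvB : v ∈ B
          · exact fun e => huv.ne (injB u huB v hvB e)
          · exact outB u huB v hv hvA hvB huv
      · by_cases hvA : v ∈ A
        · exact (outA v hvA u hu huA huB huv.symm).symm
        · by_cases hvB : v ∈ B
          · exact (outB v hvB u hu huA huB huv.symm).symm
          · rw [cO' u huA huB, cO' v hvA hvB]
            exact hc u hu v hv ((hnon u v (by tauto)).2 huv)

end
end Ico

namespace Ico
section
variable {V : Type*}

lemma skel_step (G : SimpleGraph V) (S : Finset V) (f : V → ℕ) (a b : ℕ) (hab : a ≠ b)
    (ha : AA 0 a a = true) (hb : AA 0 b b = true)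
    (h1 : ∀ u ∈ S, ∀ v ∈ S, u ≠ v → f u = a → f v ≠ b → (G.Adj u v ↔ AA 0 a (f v) = true))
    (h2 : ∀ u ∈ S, ∀ v ∈ S, u ≠ v → f u = b → f v ≠ a → (G.Adj u v ↔ AA 0 b (f v) = true)) :
    ∃ G' : SimpleGraph V, ∃ K : Set V, G' ≤ G ∧
      (∀ u ∈ S, ∀ v ∈ S, ¬ (f u = a ∧ f v = b ∨ f u = b ∧ f v = a) →
        (G'.Adj u v ↔ G.Adj u v)) ∧
      (∀ u ∈ S, ∀ v ∈ S, f u = a → f v = b → (G'.Adj u v ↔ u ∈ K ∧ v ∈ K)) ∧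
      ∀ k, Col G' S k → Col G S k := by
  classical
  obtain ⟨G', K, g1, g2, g3, g4⟩ := skel G S (S.filter (fun v => f v = a))
    (S.filter (fun v => f v = b)) (Finset.filter_subset _ _) (Finset.filter_subset _ _)
    (by
      rw [Finset.disjoint_left]
      intro v hv hv'
      rw [Finset.mem_filter] at hv hv'
      exact hab (hv.2.symm.trans hv'.2))
    (by
      intro u hu v hv huv
      rw [Finset.mem_coe, Finset.mem_filter] at hu hv
      exact (h1 u hu.1 v hv.1 huv hu.2 (by rw [hv.2]; exact hab)).2 (by rw [hv.2]; exact ha))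
    (by
      intro u hu v hv huv
      rw [Finset.mem_coe, Finset.mem_filter] at hu hv
      exact (h2 u hu.1 v hv.1 huv hu.2 (by rw [hv.2]; exact hab.symm)).2 (by rw [hv.2]; exact hb))
    (by
      rintro v hv hvA hvB ⟨x, hx, hxv⟩ y hy
      rw [Finset.mem_filter] at hx hy
      have hvb : f v ≠ b := fun e => hvB (Finset.mem_filter.2 ⟨hv, e⟩)
      have hva : f v ≠ a := fun e => hvA (Finset.mem_filter.2 ⟨hv, e⟩)
      have := (h1 x hx.1 v hv hxv.ne hx.2 hvb).1 hxv
      exact (h1 y hy.1 v hv (by rintro rfl; exact hva hy.2) hy.2 hvb).2 this)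
    (by
      rintro v hv hvA hvB ⟨x, hx, hxv⟩ y hy
      rw [Finset.mem_filter] at hx hy
      have hvb : f v ≠ b := fun e => hvB (Finset.mem_filter.2 ⟨hv, e⟩)
      have hva : f v ≠ a := fun e => hvA (Finset.mem_filter.2 ⟨hv, e⟩)
      have := (h2 x hx.1 v hv hxv.ne hx.2 hva).1 hxv
      exact (h2 y hy.1 v hv (by rintro rfl; exact hvb hy.2) hy.2 hva).2 this)
  refine ⟨G', K, g1, ?_, ?_, g4⟩
  · intro u hu v hv h
    apply g2
    simp only [Finset.mem_filter, hu, hv, true_and]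
    exact h
  · intro u hu v hv hua hvb
    exact g3 u (Finset.mem_filter.2 ⟨hu, hua⟩) v (Finset.mem_filter.2 ⟨hv, hvb⟩)

/-- The four labels that get split. -/
def isS (a : ℕ) : Bool := [1, 4, 6, 9].contains a

/-- The split label. -/
def lb (a : ℕ) (t : Bool) : ℕ := if isS a && !t then a + 10 else a

/-- Special pairs of labels. -/
def sp (a b : ℕ) : Bool :=
  (a == 1 && b == 4) || (a == 4 && b == 1) || (a == 6 && b == 9) || (a == 9 && b == 6)

/-- The fourteen labels. -/
def W14 : List ℕ := [0, 1, 2, 3, 4, 5, 6, 7, 8, 9, 11, 14, 16, 19]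

lemma lb_mem : ∀ a < 10, ∀ t, lb a t ∈ W14 := by decide +kernel

lemma lb_ns : ∀ a < 10, ∀ b < 10, sp a b = false → ∀ s t,
    AA 0 (lb a s) (lb b t) = AA 0 a b := by decide +kernel

lemma lb_sp : ∀ a < 10, ∀ b < 10, sp a b = true → ∀ s t,
    AA 0 (lb a s) (lb b t) = (s && t) := by decide +kernel

lemma sp_cases : ∀ a < 10, ∀ b < 10, sp a b = true →
    (a = 1 ∧ b = 4) ∨ (a = 4 ∧ b = 1) ∨ (a = 6 ∧ b = 9) ∨ (a = 9 ∧ b = 6) := by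
  intro a _ b _ h
  simp only [sp, Bool.or_eq_true, Bool.and_eq_true, beq_iff_eq] at h
  tauto

lemma sp1 : ∀ b < 10, b ≠ 4 → sp 1 b = false := by decide +kernel
lemma sp4 : ∀ b < 10, b ≠ 1 → sp 4 b = false := by decide +kernel
lemma sp6 : ∀ b < 10, b ≠ 9 → sp 6 b = false := by decide +kernel
lemma sp9 : ∀ b < 10, b ≠ 6 → sp 9 b = false := by decide +kernel

lemma col_of_pat {G : SimpleGraph V} {g : ℕ} {Ws : List ℕ} (hr : Refuted G (g, Ws, []))
    (S : Finset V) (f : V → ℕ) (p : Pat G S (AA g) Ws f) (k : ℕ) (q : QQ G S k) : Col G S k :=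
  no_ce (fun S' k' h p' => hr S' k' f h p' (fun w => by simp)) S k p q

lemma case2 (G : SimpleGraph V) (S : Finset V) (f : V → ℕ) (k : ℕ) (hf : ∀ v ∈ S, f v < 10)
    (h : ∀ u ∈ S, ∀ v ∈ S, u ≠ v → sp (f u) (f v) = false →
      (G.Adj u v ↔ AA 0 (f u) (f v) = true)) (q : QQ G S k) : Col G S k := by
  classical
  obtain ⟨G1, K1, a1, a2, a3, a4⟩ := skel_step G S f 1 4 (by decide) (by decide) (by decide)
    (fun u hu v hv huv e e' => by
      have := h u hu v hv huv (by rw [e]; exact sp1 _ (hf v hv) e')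
      rwa [e] at this)
    (fun u hu v hv huv e e' => by
      have := h u hu v hv huv (by rw [e]; exact sp4 _ (hf v hv) e')
      rwa [e] at this)
  obtain ⟨G2, K2, b1, b2, b3, b4⟩ := skel_step G1 S f 6 9 (by decide) (by decide) (by decide)
    (fun u hu v hv huv e e' => by
      have := h u hu v hv huv (by rw [e]; exact sp6 _ (hf v hv) e')
      rw [e] at this
      rw [← this]
      exact a2 u hu v hv (by omega))
    (fun u hu v hv huv e e' => by
      have := h u hu v hv huv (by rw [e]; exact sp9 _ (hf v hv) e')
      rw [e] at this
      rw [← this]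
      exact a2 u hu v hv (by omega))
  let t : V → Bool := fun v => if f v = 1 ∨ f v = 4 then decide (v ∈ K1) else decide (v ∈ K2)
  apply a4
  apply b4
  have hr : Refuted G2 (0, W14, []) := rf_hh cf_hh (by simp [ev_hh])
  refine col_of_pat hr S (fun v => lb (f v) (t v)) ⟨by decide, by decide, ?_, ?_⟩ k
    (q.le (b1.trans a1))
  · intro v hv
    exact lb_mem _ (hf v hv) _
  · have c1 : ∀ u ∈ S, ∀ v ∈ S, f u = 1 → f v = 4 → (G2.Adj u v ↔ (t u && t v) = true) := by
      intro u hu v hv e e'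
      rw [b2 u hu v hv (by omega), a3 u hu v hv e e']
      simp [t, e, e']
    have c2 : ∀ u ∈ S, ∀ v ∈ S, f u = 6 → f v = 9 → (G2.Adj u v ↔ (t u && t v) = true) := by
      intro u hu v hv e e'
      rw [b3 u hu v hv e e']
      simp [t, e, e']
    intro u hu v hv huv
    cases hs : sp (f u) (f v)
    · rw [lb_ns _ (hf u hu) _ (hf v hv) hs, ← h u hu v hv huv hs]
      have hns : ¬ (f u = 1 ∧ f v = 4 ∨ f u = 4 ∧ f v = 1) ∧
          ¬ (f u = 6 ∧ f v = 9 ∨ f u = 9 ∧ f v = 6) := by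
        constructor
        · rintro (⟨e, e'⟩ | ⟨e, e'⟩) <;> rw [e, e'] at hs <;> exact absurd hs (by decide)
        · rintro (⟨e, e'⟩ | ⟨e, e'⟩) <;> rw [e, e'] at hs <;> exact absurd hs (by decide)
      rw [b2 u hu v hv hns.2, a2 u hu v hv hns.1]
    · rw [lb_sp _ (hf u hu) _ (hf v hv) hs]
      rcases sp_cases _ (hf u hu) _ (hf v hv) hs with ⟨e, e'⟩ | ⟨e, e'⟩ | ⟨e, e'⟩ | ⟨e, e'⟩
      · exact c1 u hu v hv e e'
      · rw [G2.adj_comm, Bool.and_comm]; exact c1 v hv u hu e' e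
      · exact c2 u hu v hv e e'
      · rw [G2.adj_comm, Bool.and_comm]; exact c2 v hv u hu e' e

end
end Ico

namespace Ico

lemma chrom_le {V : Type*} [Fintype V] (H : SimpleGraph V)
    (h : ∀ k, QQ H Finset.univ k → Col H Finset.univ k) :
    H.chromaticNumber ≤ (gammaLocal H : ℕ∞) := by
  classical
  obtain ⟨c, h1, h2⟩ := h (gammaLocal H) (by
    intro v _ K _ hK hvK
    have hcn : (cn H Finset.univ v).card = degree' H v + 1 := by
      have e : cn H Finset.univ v = insert v (Finset.univ.filter (fun u => H.Adj v u)) := by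
        ext u
        simp [cn]
      rw [e, Finset.card_insert_of_notMem (by simp), degree', ← Set.ncard_coe_finset]
      congr 2
      ext u
      simp
    have hom : K.card ≤ omegaAt H v := by
      apply le_csSup
      · refine ⟨Fintype.card V, ?_⟩
        rintro n ⟨s, hs, _⟩
        rw [← hs.card_eq]
        exact Finset.card_le_univ s
      · exact ⟨K, ⟨hK, rfl⟩, hvK⟩
    have hga : gammaLocalAt H v ≤ gammaLocal H := by
      apply le_csSup
      · have : {n | ∃ v, n = gammaLocalAt H v} = Set.range (gammaLocalAt H) := by
          ext n
          simp [eq_comm]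
        rw [this]
        exact (Set.finite_range _).bddAbove
      · exact ⟨v, rfl⟩
    unfold gammaLocalAt at hga
    omega)
  have hc : H.Colorable (gammaLocal H) :=
    ⟨SimpleGraph.Coloring.mk (fun v => (⟨c v, h1 v (Finset.mem_univ v)⟩ : Fin (gammaLocal H)))
      (fun {u v} huv e => h2 u (Finset.mem_univ u) v (Finset.mem_univ v) huv
        (congrArg Fin.val e))⟩
  exact hc.chromaticNumber_le

lemma ico0_adj : ∀ a b : Fin 12, a ≠ b →
    (icoG0.Adj a b ↔ AA 1 a.val b.val = true) := by
  simp only [icoG0, SimpleGraph.fromRel_adj]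
  decide +kernel

lemma ico1_adj : ∀ a b : Fin 11, a ≠ b →
    (icoG1.Adj a b ↔ AA 1 a.val b.val = true) := by
  simp only [icoG1, SimpleGraph.fromRel_adj]
  decide +kernel

lemma ico2_adj : ∀ a b : Fin 10, a ≠ b → sp a.val b.val = false →
    (icoG2.Adj a b ↔ AA 0 a.val b.val = true) := by
  simp only [icoG2, SimpleGraph.fromRel_adj]
  decide +kernel

lemma rf1 : ∀ a < 12, AA 1 a a = true := by decide +kernel
lemma rf0 : ∀ a < 10, AA 0 a a = true := by decide +kernel

lemma sp_notMem (M : Set (Sym2 (Fin 10))) (hM : M ⊆ {s((1 : Fin 10), 4), s(6, 9)}) (a b : Fin 10)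
    (h : sp a.val b.val = false) : s(a, b) ∉ M := by
  intro hm
  have h1 := hM hm
  simp only [Set.mem_insert_iff, Set.mem_singleton_iff, Sym2.eq_iff] at h1
  rcases h1 with (⟨rfl, rfl⟩ | ⟨rfl, rfl⟩) | (⟨rfl, rfl⟩ | ⟨rfl, rfl⟩) <;>
    exact absurd h (by decide)

/-- Adjacency in a thickening, for pairs of labels outside the matching. -/
lemma thick_adj {V W : Type*} {H : SimpleGraph W} {M : Set (Sym2 W)} {G : SimpleGraph V}
    {f : V → W} (ht : IsThickening H M G f) (u v : V) (huv : u ≠ v) (hM : s(f u, f v) ∉ M) :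
    G.Adj u v ↔ (f u = f v ∨ H.Adj (f u) (f v)) := by
  by_cases e : f u = f v
  · simp only [e, true_or, iff_true]
    exact ht.fibers_clique (f v) ⟨Set.mem_univ _, e⟩ ⟨Set.mem_univ _, rfl⟩ huv
  · simp only [e, false_or]
    constructor
    · intro h
      by_contra hn
      exact ht.nonadj_of_nonadj u (Set.mem_univ _) v (Set.mem_univ _) e hn h
    · intro h
      exact ht.adj_of_adj u (Set.mem_univ _) v (Set.mem_univ _) e h hM

end Ico

theorem stmt7 {V : Type*} [Fintype V] (G : SimpleGraph V)
    (hic : IsIcosahedralThickening G) (S : Set V) :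
    (G.induce S).chromaticNumber ≤ (gammaLocal (G.induce S) : ℕ∞) := by
  classical
  apply Ico.chrom_le
  intro k q
  rcases hic with ⟨f, ht⟩ | ⟨f, ht⟩ | ⟨M, f, hM, ht⟩
  · have hr : Ico.Refuted (G.induce S) (1, [0, 1, 2, 3, 4, 5, 6, 7, 8, 9, 10, 11], []) :=
      Ico.rf_ico Ico.cf_ico (by simp [Ico.ev_ico])
    refine Ico.col_of_pat hr Finset.univ (fun v => (f v.1).val)
      ⟨by decide, by decide, ?_, ?_⟩ k q
    · intro v _
      have := (f v.1).isLt
      simp only [List.mem_cons, List.not_mem_nil, or_false]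
      omega
    · intro u _ v _ huv
      rw [SimpleGraph.comap_adj]
      refine (Ico.thick_adj ht u.1 v.1 (fun e => huv (Subtype.ext e)) (by simp)).trans ?_
      by_cases e : f u.1 = f v.1
      · simp only [e, true_or, true_iff]
        exact Ico.rf1 _ (f v.1).isLt
      · simp only [e, false_or]
        exact Ico.ico0_adj _ _ e
  · have hr : Ico.Refuted (G.induce S) (1, [0, 1, 2, 3, 4, 5, 6, 7, 8, 9, 10], []) :=
      Ico.rf_b Ico.cf_b (by simp [Ico.ev_b])
    refine Ico.col_of_pat hr Finset.univ (fun v => (f v.1).val)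
      ⟨by decide, by decide, ?_, ?_⟩ k q
    · intro v _
      have := (f v.1).isLt
      simp only [List.mem_cons, List.not_mem_nil, or_false]
      omega
    · intro u _ v _ huv
      rw [SimpleGraph.comap_adj]
      refine (Ico.thick_adj ht u.1 v.1 (fun e => huv (Subtype.ext e)) (by simp)).trans ?_
      by_cases e : f u.1 = f v.1
      · simp only [e, true_or, true_iff]
        exact Ico.rf1 _ (by omega)
      · simp only [e, false_or]
        exact Ico.ico1_adj _ _ e
  · refine Ico.case2 (G.induce S) Finset.univ (fun v => (f v.1).val) k
      (fun v _ => (f v.1).isLt) ?_ q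
    intro u _ v _ huv hsp
    have hn := Ico.sp_notMem M hM _ _ hsp
    rw [SimpleGraph.comap_adj]
    refine (Ico.thick_adj ht u.1 v.1 (fun e => huv (Subtype.ext e)) hn).trans ?_
    by_cases e : f u.1 = f v.1
    · simp only [e, true_or, true_iff]
      exact Ico.rf0 _ (f v.1).isLt
    · simp only [e, false_or]
      rw [← Ico.ico2_adj _ _ e hsp, SimpleGraph.sup_adj, SimpleGraph.fromEdgeSet_adj]
      simp only [hn, false_and, or_false]

end Paper
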